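/- arXiv:1806.04538 — 4 statements merged into one kernel-verified Lean document; each statement's English description precedes it below -/
import Mathlib

section
/- Assume n ≥ 3 and set u = (G_n G_{n−1})^{p−1}. For every e ≥ 0, multiplication by u^{p^e} maps Ω^{[p^e]} into Ω^{[p^{e+1}]}, and the local cohomology module H^3_{I_{n−1}(X) + I_{n−2}(X′)}(k[[X]]) = H^3_Ω(R) is isomorphic to the colimit of the direct system R/Ω → R/Ω^{[p]} → R/Ω^{[p^2]} → ⋯ whose e-th transition map R/Ω^{[p^e]} → R/Ω^{[p^{e+1}]} is induced by multiplication by u^{p^e}. -/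
/-- `𝔞^{[q]}`: the ideal generated by the `q`-th powers of all elements of `𝔞`. -/
def frobPow {R : Type} [CommRing R] (q : ℕ) (a : Ideal R) : Ideal R :=
  Ideal.span ((fun x => x ^ q) '' (a : Set R))

/-- For the generic `n × (n-1)` matrix `X` (with `n = m + 2`) over `R = k[[X]]`,
`Gmin k m i` is the maximal minor obtained by deleting the `i`-th row. -/
noncomputable def Gmin (k : Type) [Field k] (m : ℕ) (i : Fin (m + 2)) :
    MvPowerSeries (Fin (m + 2) × Fin (m + 1)) k :=
  (Matrix.of fun r c : Fin (m + 1) =>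
    (MvPowerSeries.X (i.succAbove r, c) : MvPowerSeries (Fin (m + 2) × Fin (m + 1)) k)).det

/-- `gmin k m j` is the `(n-2) × (n-2)` minor of the submatrix `X'` formed by the first
`n - 2` rows of `X`, obtained by deleting the `j`-th column. -/
noncomputable def gmin (k : Type) [Field k] (m : ℕ) (j : Fin (m + 1)) :
    MvPowerSeries (Fin (m + 2) × Fin (m + 1)) k :=
  (Matrix.of fun r c : Fin m =>
    (MvPowerSeries.X (Fin.castAdd 2 r, j.succAbove c) :
      MvPowerSeries (Fin (m + 2) × Fin (m + 1)) k)).det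

/-- `I = I_{n-1}(X)`, the ideal of maximal minors. -/
noncomputable def Imax (k : Type) [Field k] (m : ℕ) :
    Ideal (MvPowerSeries (Fin (m + 2) × Fin (m + 1)) k) :=
  Ideal.span (Set.range (Gmin k m))

/-- `P = I_{n-2}(X')` (equal to `R` when `n = 2`). -/
noncomputable def Psub (k : Type) [Field k] (m : ℕ) :
    Ideal (MvPowerSeries (Fin (m + 2) × Fin (m + 1)) k) :=
  Ideal.span (Set.range (gmin k m))

/-- `Ω = I + P`. -/
noncomputable def Omeg (k : Type) [Field k] (m : ℕ) :
    Ideal (MvPowerSeries (Fin (m + 2) × Fin (m + 1)) k) :=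
  Imax k m ⊔ Psub k m


/-- `u = (G_n G_{n-1})^{p-1}`. -/
noncomputable def ugen (k : Type) [Field k] (m p : ℕ) :
    MvPowerSeries (Fin (m + 2) × Fin (m + 1)) k :=
  (Gmin k m (Fin.last (m + 1)) * Gmin k m (Fin.castSucc (Fin.last m))) ^ (p - 1)

/-- The `R`-module `R/Ω^{[p^e]}`. -/
abbrev quotFrobOm (k : Type) [Field k] (m p e : ℕ) : Type :=
  MvPowerSeries (Fin (m + 2) × Fin (m + 1)) k ⧸ frobPow (p ^ e) (Omeg k m)

namespace PfaffianLink

open Matrix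

section Algebra

variable {R : Type} [CommRing R] {N : ℕ}

/-- The submatrix formed by all rows but the last two. -/
def top (X : Matrix (Fin (N + 2)) (Fin (N + 1)) R) : Matrix (Fin N) (Fin (N + 1)) R :=
  X.submatrix (Fin.castAdd 2) id

/-- The penultimate row. -/
def penult (X : Matrix (Fin (N + 2)) (Fin (N + 1)) R) : Fin (N + 1) → R :=
  X (Fin.last N).castSucc

/-- The last row. -/
def ult (X : Matrix (Fin (N + 2)) (Fin (N + 1)) R) : Fin (N + 1) → R :=
  X (Fin.last (N + 1))

/-- The maximal minor omitting row `i`. -/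
def bigMinor (X : Matrix (Fin (N + 2)) (Fin (N + 1)) R) (i : Fin (N + 2)) : R :=
  (X.submatrix i.succAbove id).det

/-- The signed maximal minor of `top X` omitting column `j`. -/
def g (X : Matrix (Fin (N + 2)) (Fin (N + 1)) R) (j : Fin (N + 1)) : R :=
  (-1) ^ (j : ℕ) * ((top X).submatrix id j.succAbove).det

/-- The signed maximal minor of `X` omitting row `i`, for `i` not one of the last two rows. -/
def γ (X : Matrix (Fin (N + 2)) (Fin (N + 1)) R) (i : Fin N) : R :=
  (-1) ^ (i : ℕ) * bigMinor X (Fin.castAdd 2 i)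

/-- The square matrix with rows `r` and those of `top X`. -/
def frame (X : Matrix (Fin (N + 2)) (Fin (N + 1)) R) (r : Fin (N + 1) → R) :
    Matrix (Fin (N + 1)) (Fin (N + 1)) R :=
  Matrix.of (Fin.cons r (top X))

variable (X : Matrix (Fin (N + 2)) (Fin (N + 1)) R)

lemma det_frame (r : Fin (N + 1) → R) : (frame X r).det = g X ⬝ᵥ r := by
  rw [det_succ_row_zero, dotProduct]
  refine Finset.sum_congr rfl fun j _ => ?_
  have : (frame X r).submatrix Fin.succ j.succAbove = (top X).submatrix id j.succAbove := by
    rfl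
  rw [this, g, show frame X r 0 j = r j from rfl]
  ring

lemma top_mulVec_g : top X *ᵥ g X = 0 := by
  ext i
  have h := det_frame X (top X i)
  rw [det_zero_of_row_eq (i := 0) (j := i.succ) (Fin.succ_ne_zero i).symm rfl] at h
  rw [mulVec, dotProduct_comm, ← h]
  rfl

lemma bigMinor_last : bigMinor X (Fin.last _) = (-1) ^ N * (g X ⬝ᵥ penult X) := by
  rw [bigMinor, det_succ_row _ (Fin.last N), dotProduct, Finset.mul_sum]
  refine Finset.sum_congr rfl fun j _ => ?_
  have : (X.submatrix (Fin.last (N+1)).succAbove id).submatrix (Fin.last N).succAbove j.succAbove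
      = (top X).submatrix id j.succAbove := by
    ext a b; simp [top]; rfl
  rw [this, g, pow_add]
  simp [penult]
  ring

lemma bigMinor_penult : bigMinor X (Fin.last N).castSucc = (-1) ^ N * (g X ⬝ᵥ ult X) := by
  rw [bigMinor, det_succ_row _ (Fin.last N), dotProduct, Finset.mul_sum]
  refine Finset.sum_congr rfl fun j _ => ?_
  have : (X.submatrix (Fin.last N).castSucc.succAbove id).submatrix
      (Fin.last N).succAbove j.succAbove = (top X).submatrix id j.succAbove := by
    ext a b
    simp [top, Fin.succAbove_of_castSucc_lt, Fin.castSucc_lt_last]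
    rfl
  rw [this, g, pow_add]
  simp [ult]
  ring

lemma sum_mul_bigMinor (j : Fin (N + 1)) :
    ∑ i : Fin (N + 2), (-1) ^ (i : ℕ) * X i j * bigMinor X i = 0 := by
  have h : (Matrix.of fun i => (Fin.cons (X i j) (X i) : Fin (N + 2) → R)).det = 0 :=
    det_zero_of_column_eq (i := 0) (j := j.succ) (Fin.succ_ne_zero j).symm (by simp)
  rw [det_succ_column_zero] at h
  exact h

lemma γ_vecMul_top :
    γ X ᵥ* top X = (g X ⬝ᵥ penult X) • ult X - (g X ⬝ᵥ ult X) • penult X := by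
  ext j
  have h := sum_mul_bigMinor X j
  rw [Fin.sum_univ_castSucc, Fin.sum_univ_castSucc, bigMinor_penult, bigMinor_last] at h
  have e : ∑ i : Fin N, (-1) ^ (i : ℕ) * X i.castSucc.castSucc j * bigMinor X i.castSucc.castSucc
      = (γ X ᵥ* top X) j := by
    refine Finset.sum_congr rfl fun i _ => ?_
    simp only [γ, top, submatrix_apply, id]
    change _ = (-1) ^ (i : ℕ) * bigMinor X i.castSucc.castSucc * X i.castSucc.castSucc j
    ring
  have s : ((-1 : R) ^ N) * (-1) ^ N = 1 := by rw [← mul_pow]; simp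
  simp only [Fin.val_castSucc, Fin.val_last] at h
  rw [e] at h
  simp only [Pi.sub_apply, Pi.smul_apply, smul_eq_mul, ult, penult] at h ⊢
  linear_combination h - (X (Fin.last N).castSucc j * (g X ⬝ᵥ X (Fin.last (N + 1)))
    - X (Fin.last (N + 1)) j * (g X ⬝ᵥ X (Fin.last N).castSucc)) * s


/-- The free module in the middle degrees of the resolution. -/
abbrev Mid (R : Type) (N : ℕ) : Type := (Fin N → R) × (Fin (N + 1) → R)

/-- The first differential, with entries the generators of the ideal. -/
def d₁ : Mid R N →ₗ[R] R where
  toFun z := γ X ⬝ᵥ z.1 + g X ⬝ᵥ z.2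
  map_add' x y := by simp only [Prod.fst_add, Prod.snd_add, dotProduct_add]; ring
  map_smul' c x := by simp only [Prod.smul_fst, Prod.smul_snd, dotProduct_smul, smul_eq_mul,
    RingHom.id_apply]; ring

/-- The second differential, given by a skew-symmetric matrix up to signs. -/
def d₂ : Mid R N →ₗ[R] Mid R N where
  toFun y := (top X *ᵥ y.2,
    y.1 ᵥ* top X + ((penult X ⬝ᵥ y.2) • ult X - (ult X ⬝ᵥ y.2) • penult X))
  map_add' x y := by
    ext : 1
    · simp [mulVec_add]
    · simp only [Prod.fst_add, Prod.snd_add, dotProduct_add, add_vecMul]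
      module
  map_smul' c x := by
    ext : 1
    · simp [mulVec_smul]
    · simp only [Prod.smul_fst, Prod.smul_snd, dotProduct_smul, smul_eq_mul, RingHom.id_apply,
        smul_vecMul]
      module

/-- The third differential. -/
def d₃ : R →ₗ[R] Mid R N where
  toFun h := (-(h • γ X), h • g X)
  map_add' x y := by
    ext : 1
    · simp only [add_smul, Prod.mk_add_mk]; abel
    · simp only [add_smul, Prod.mk_add_mk]
  map_smul' c x := by
    ext : 1
    · simp only [smul_eq_mul, mul_smul, RingHom.id_apply, Prod.smul_mk, smul_neg]
    · simp only [smul_eq_mul, mul_smul, RingHom.id_apply, Prod.smul_mk]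

lemma d₁_apply (z : Mid R N) : d₁ X z = γ X ⬝ᵥ z.1 + g X ⬝ᵥ z.2 := rfl

lemma d₂_apply (y : Mid R N) : d₂ X y = (top X *ᵥ y.2,
    y.1 ᵥ* top X + ((penult X ⬝ᵥ y.2) • ult X - (ult X ⬝ᵥ y.2) • penult X)) := rfl

lemma d₃_apply (h : R) : d₃ X h = (-(h • γ X), h • g X) := rfl

lemma d₁_d₂ (y : Mid R N) : d₁ X (d₂ X y) = 0 := by
  rw [d₂_apply, d₁_apply, dotProduct_mulVec, γ_vecMul_top, dotProduct_add,
    dotProduct_comm _ (_ ᵥ* _),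
    ← dotProduct_mulVec, top_mulVec_g]
  simp only [sub_dotProduct, smul_dotProduct, dotProduct_zero, dotProduct_sub, dotProduct_smul,
    smul_eq_mul]
  ring

lemma d₂_d₃ (h : R) : d₂ X (d₃ X h) = 0 := by
  rw [d₃_apply, d₂_apply, mulVec_smul, top_mulVec_g, neg_vecMul, smul_vecMul, γ_vecMul_top,
    dotProduct_smul, dotProduct_smul, dotProduct_comm (penult X), dotProduct_comm (ult X)]
  ext : 1
  · simp
  · simp only [Prod.snd_zero, smul_eq_mul]
    module

/-- `a, b` is a regular pair, in terms of relations. -/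
def RegPair (a b : R) : Prop := ∀ x y : R, x * a = y * b → ∃ c, x = c * b ∧ y = c * a

/-- All relations on `a, b, c` are Koszul relations. -/
def KoszulTriple (a b c : R) : Prop := ∀ x y z : R, x * a + y * b + z * c = 0 →
  ∃ r s t, x = b * t - c * s ∧ y = c * r - a * t ∧ z = a * s - b * r

lemma RegPair.mid {a b : R} (h : RegPair a b) (x y : Mid R N) (e : a • x = b • y) :
    ∃ c, x = b • c ∧ y = a • c := by
  have h1 : ∀ i, ∃ c, x.1 i = c * b ∧ y.1 i = c * a := fun i => h _ _ (by
    have := congrFun (congrArg Prod.fst e) i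
    simpa [mul_comm] using this)
  have h2 : ∀ i, ∃ c, x.2 i = c * b ∧ y.2 i = c * a := fun i => h _ _ (by
    have := congrFun (congrArg Prod.snd e) i
    simpa [mul_comm] using this)
  choose c hc hc' using h1
  choose c' hd hd' using h2
  refine ⟨(c, c'), ?_, ?_⟩ <;> ext i <;> simp [hc, hc', hd, hd', mul_comm]

lemma frame_single_mul (X : Matrix (Fin (N + 2)) (Fin (N + 1)) R) (l : Fin (N + 1)) :
    (frame X (Pi.single l 1)).det = g X l := by
  simp [det_frame]

lemma adjugate_frame_zero (r : Fin (N + 1) → R) (j : Fin (N + 1)) :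
    (frame X r).adjugate j 0 = g X j := by
  rw [adjugate_apply, ← frame_single_mul]
  congr 1
  ext a b
  refine Fin.cases ?_ (fun i => ?_) a
  · rw [updateRow_self]; rfl
  · rw [updateRow_ne (Fin.succ_ne_zero i)]; rfl

lemma frame_mulVec (r y : Fin (N + 1) → R) :
    frame X r *ᵥ y = Fin.cons (r ⬝ᵥ y) (top X *ᵥ y) := by
  ext a
  refine Fin.cases ?_ (fun i => ?_) a <;> rfl

lemma vecMul_frame (r t : Fin (N + 1) → R) :
    t ᵥ* frame X r = t 0 • r + Fin.tail t ᵥ* top X := by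
  ext j
  simp only [vecMul, dotProduct, Fin.sum_univ_succ, Pi.add_apply, Pi.smul_apply, smul_eq_mul]
  rfl

lemma mul_g_comm {y : Fin (N + 1) → R} (hy : top X *ᵥ y = 0) (j l : Fin (N + 1)) :
    y j * g X l = y l * g X j := by
  have h : (frame X (Pi.single l 1)).adjugate *ᵥ (frame X (Pi.single l 1) *ᵥ y) =
      g X l • y := by
    rw [mulVec_mulVec, adjugate_mul, frame_single_mul, smul_mulVec, one_mulVec]
  rw [frame_mulVec, hy] at h
  have := congrFun h j
  rw [mulVec, dotProduct, Fin.sum_univ_succ] at this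
  simp only [Fin.cons_zero, adjugate_frame_zero, Fin.cons_succ, single_one_dotProduct,
    Pi.zero_apply, mul_zero, Finset.sum_const_zero, add_zero, Pi.smul_apply, smul_eq_mul] at this
  linear_combination -this

lemma top_solve (l : Fin (N + 1)) (z : Fin N → R) :
    ∃ y, top X *ᵥ y = g X l • z := by
  refine ⟨(frame X (Pi.single l 1)).adjugate *ᵥ Fin.cons 0 z, ?_⟩
  have h : frame X (Pi.single l 1) *ᵥ ((frame X (Pi.single l 1)).adjugate *ᵥ Fin.cons 0 z) =
      g X l • (Fin.cons 0 z : Fin (N + 1) → R) := by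
    rw [mulVec_mulVec, mul_adjugate, frame_single_mul, smul_mulVec, one_mulVec]
  rw [frame_mulVec] at h
  ext i
  simpa using congrFun h i.succ

lemma vecMul_solve (l : Fin (N + 1)) {z : Fin (N + 1) → R} (hz : g X ⬝ᵥ z = 0) :
    ∃ y, y ᵥ* top X = g X l • z := by
  have h : (z ᵥ* (frame X (Pi.single l 1)).adjugate) ᵥ* frame X (Pi.single l 1) = g X l • z := by
    rw [vecMul_vecMul, adjugate_mul, frame_single_mul, vecMul_smul, vecMul_one]
  have h0 : (z ᵥ* (frame X (Pi.single l 1)).adjugate) 0 = 0 := by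
    rw [← hz, dotProduct_comm, vecMul, dotProduct, dotProduct]
    simp [adjugate_frame_zero]
  rw [vecMul_frame, h0, zero_smul, zero_add] at h
  exact ⟨_, h⟩

lemma vecMul_top_injective [IsDomain R] {l : Fin (N + 1)} (hl : g X l ≠ 0) {y : Fin N → R}
    (hy : y ᵥ* top X = 0) : y = 0 := by
  have h : (Fin.cons 0 y : Fin (N + 1) → R) ᵥ* frame X (Pi.single l 1) = 0 := by
    rw [vecMul_frame]; simpa using hy
  have h2 := eq_zero_of_vecMul_eq_zero (by rwa [frame_single_mul]) h
  ext i
  simpa using congrFun h2 i.succ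

lemma d₃_injective [IsDomain R] {l : Fin (N + 1)} (hl : g X l ≠ 0) {h : R} (e : d₃ X h = 0) :
    h = 0 := by
  have := congrFun (congrArg Prod.snd e) l
  simpa [d₃_apply, hl] using this

lemma ker_d₂ [IsDomain R] {j l : Fin (N + 1)} (hl : g X l ≠ 0)
    (hreg : RegPair (g X j) (g X l)) {y : Mid R N} (hy : d₂ X y = 0) : ∃ h, d₃ X h = y := by
  rw [d₂_apply] at hy
  have hy1 : top X *ᵥ y.2 = 0 := congrArg Prod.fst hy
  have hy2 : y.1 ᵥ* top X + ((penult X ⬝ᵥ y.2) • ult X - (ult X ⬝ᵥ y.2) • penult X) = 0 :=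
    congrArg Prod.snd hy
  obtain ⟨c, hc, -⟩ := hreg (y.2 l) (y.2 j) (mul_g_comm X hy1 l j)
  have h2 : y.2 = c • g X := by
    ext i
    have := mul_g_comm X hy1 i l
    rw [hc] at this
    refine mul_right_cancel₀ hl ?_
    rw [this, Pi.smul_apply, smul_eq_mul]
    ring
  refine ⟨c, ?_⟩
  rw [d₃_apply]
  ext1
  · have h3 : (y.1 + c • γ X) ᵥ* top X = 0 := by
      rw [← hy2, add_vecMul, smul_vecMul, γ_vecMul_top, h2, dotProduct_smul,
        dotProduct_smul, dotProduct_comm (penult X), dotProduct_comm (ult X)]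
      simp only [smul_eq_mul]
      module
    rw [eq_neg_of_add_eq_zero_left (vecMul_top_injective X hl h3)]
  · exact h2.symm

lemma g_sq_smul_mem {z : Mid R N} (hz : d₁ X z = 0) (l : Fin (N + 1)) :
    ∃ y, d₂ X y = (g X l) ^ 2 • z := by
  obtain ⟨y, hy⟩ := top_solve X l z.1
  have h : d₁ X (g X l • z - d₂ X (0, y)) = 0 := by
    rw [map_sub, map_smul, hz, d₁_d₂, smul_zero, sub_zero]
  have h1 : (d₂ X (0, y)).1 = g X l • z.1 := hy
  rw [d₁_apply, Prod.fst_sub, Prod.smul_fst, h1, sub_self, dotProduct_zero, zero_add] at h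
  obtain ⟨x, hx⟩ := vecMul_solve X l h
  refine ⟨(x, g X l • y), ?_⟩
  have e : ((x, g X l • y) : Mid R N) = (x, 0) + g X l • ((0, y) : Mid R N) := by
    simp
  rw [e, map_add, map_smul]
  have e1 : d₂ X (x, 0) = (0, x ᵥ* top X) := by simp [d₂_apply]
  rw [e1, hx]
  ext1
  · simp only [Prod.fst_add, Prod.smul_fst, h1, zero_add, smul_smul, sq]
  · simp only [Prod.snd_add, Prod.smul_snd, Prod.snd_sub]
    module

lemma vecMul_eq (t : Fin (N + 2) → R) : t ᵥ* X = (fun i => t (Fin.castAdd 2 i)) ᵥ* top X +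
    t (Fin.last N).castSucc • penult X + t (Fin.last (N + 1)) • ult X := by
  ext j
  simp only [vecMul, dotProduct, Fin.sum_univ_castSucc, Pi.add_apply, Pi.smul_apply, smul_eq_mul]
  rfl

lemma bigMinor_sq_smul_mem [IsDomain R] [NeZero N] (h0 : γ X 0 ≠ 0) {z : Mid R N}
    (hz : d₁ X z = 0) : ∃ y, d₂ X y = (γ X 0) ^ 2 • z := by
  set V := X.submatrix (Fin.succAbove 0) id with hV
  have hΔ : γ X 0 = V.det := by
    have : (Fin.castAdd 2 (0 : Fin N)) = 0 := rfl
    rw [γ, this]; simp [bigMinor, hV]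
  set Δ := γ X 0 with hΔ'
  set t : Fin (N + 2) → R := Fin.cons 0 (z.2 ᵥ* V.adjugate) with ht
  have h1 : t ᵥ* X = Δ • z.2 := by
    have : (z.2 ᵥ* V.adjugate) ᵥ* V = Δ • z.2 := by
      rw [vecMul_vecMul, adjugate_mul, hΔ, vecMul_smul, vecMul_one]
    rw [← this]
    ext j
    simp [vecMul, dotProduct, Fin.sum_univ_succ, ht, hV]
  rw [vecMul_eq] at h1
  set r : Fin (N + 2) → R := Fin.append (Δ • z.1)
    ![t (Fin.last (N + 1)), -t (Fin.last N).castSucc] with hr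
  set y := V.adjugate *ᵥ Fin.tail r with hy
  have h2 : ∀ i : Fin (N + 2), i ≠ 0 → (X *ᵥ y) i = Δ * r i := by
    have : V *ᵥ y = Δ • Fin.tail r := by
      rw [hy, mulVec_mulVec, mul_adjugate, hΔ, smul_mulVec, one_mulVec]
    intro i hi
    obtain ⟨k, rfl⟩ := Fin.exists_succ_eq.mpr hi
    exact congrFun this k
  have ha : penult X ⬝ᵥ y = Δ * t (Fin.last (N + 1)) := by
    have e : (Fin.last N).castSucc = Fin.natAdd N (0 : Fin 2) := rfl
    have := h2 (Fin.last N).castSucc (by simp [Fin.ext_iff, NeZero.ne N])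
    rw [hr, e, Fin.append_right] at this
    exact this
  have hb : ult X ⬝ᵥ y = -(Δ * t (Fin.last N).castSucc) := by
    have e : Fin.last (N + 1) = Fin.natAdd N (1 : Fin 2) := rfl
    have := h2 (Fin.last (N + 1)) (by simp [Fin.ext_iff])
    rw [hr, e, Fin.append_right] at this
    refine Eq.trans this ?_
    simp
  have hD : ∀ i ≠ 0, (top X *ᵥ y) i = (Δ ^ 2 • z).1 i := by
    intro i hi
    have := h2 (Fin.castAdd 2 i) (fun h => hi (Fin.ext (congrArg Fin.val h :)))
    rw [hr, Fin.append_left] at this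
    refine Eq.trans this ?_
    simp; ring
  refine ⟨(Δ • fun i => t (Fin.castAdd 2 i), y), ?_⟩
  have hs : (d₂ X (Δ • fun i => t (Fin.castAdd 2 i), y)).2 = (Δ ^ 2 • z).2 := by
    rw [Prod.smul_snd, sq, ← smul_smul, ← h1, d₂_apply, ha, hb]
    simp only [smul_vecMul]
    module
  have h3 : d₁ X (Δ ^ 2 • z - d₂ X (Δ • fun i => t (Fin.castAdd 2 i), y)) = 0 := by
    rw [map_sub, map_smul, hz, d₁_d₂, smul_zero, sub_zero]
  rw [d₁_apply, Prod.snd_sub, hs, sub_self, dotProduct_zero, add_zero, dotProduct,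
    Finset.sum_eq_single 0] at h3
  · have h4 := (mul_eq_zero.mp h3).resolve_left h0
    ext1
    · ext i
      by_cases hi : i = 0
      · subst hi; exact (sub_eq_zero.mp h4).symm
      · exact hD i hi
    · exact hs
  · intro i _ hi
    have : (Δ ^ 2 • z - d₂ X (Δ • fun i => t (Fin.castAdd 2 i), y)).1 i = 0 :=
      sub_eq_zero.mpr (hD i hi).symm
    rw [this, mul_zero]
  · simp

lemma ker_d₁ [IsDomain R] {j l : Fin (N + 1)} (hl : g X l ≠ 0)
    (hreg : RegPair (g X j) (g X l)) {a b c : R} (ha : a ≠ 0) (hab : RegPair a b)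
    (habc : KoszulTriple a b c) {z : Mid R N}
    (hz : ∃ y, d₂ X y = a • z) (hz' : ∃ y, d₂ X y = b • z) (hz'' : ∃ y, d₂ X y = c • z) :
    ∃ y, d₂ X y = z := by
  obtain ⟨y₁, h₁⟩ := hz
  obtain ⟨y₂, h₂⟩ := hz'
  obtain ⟨y₃, h₃⟩ := hz''
  obtain ⟨t₃, e₃⟩ := ker_d₂ X hl hreg (y := a • y₂ - b • y₁) (by
    rw [map_sub, map_smul, map_smul, h₁, h₂, smul_comm, sub_self])
  obtain ⟨t₁, e₁⟩ := ker_d₂ X hl hreg (y := b • y₃ - c • y₂) (by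
    rw [map_sub, map_smul, map_smul, h₃, h₂, smul_comm, sub_self])
  obtain ⟨t₂, e₂⟩ := ker_d₂ X hl hreg (y := c • y₁ - a • y₃) (by
    rw [map_sub, map_smul, map_smul, h₁, h₃, smul_comm, sub_self])
  have h0 : t₁ * a + t₂ * b + t₃ * c = 0 := d₃_injective X hl (by
    have : t₁ * a + t₂ * b + t₃ * c = a • t₁ + b • t₂ + c • t₃ := by
      simp only [smul_eq_mul]; ring
    rw [this, map_add, map_add, map_smul, map_smul, map_smul, e₁, e₂, e₃]
    module)
  obtain ⟨r, s, t, -, -, k₃⟩ := habc _ _ _ h0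
  have h4 : a • (y₂ - d₃ X s) = b • (y₁ - d₃ X r) := by
    have : d₃ X t₃ = a • d₃ X s - b • d₃ X r := by
      rw [k₃, ← smul_eq_mul, ← smul_eq_mul, map_sub, map_smul, map_smul]
    rw [this] at e₃
    rw [smul_sub, smul_sub, sub_eq_sub_iff_add_eq_add]
    rw [sub_eq_sub_iff_add_eq_add] at e₃
    rw [add_comm (b • y₁), e₃]
  obtain ⟨y, -, hy⟩ := hab.mid _ _ h4
  refine ⟨y, ?_⟩
  have : a • (d₂ X y - z) = 0 := by
    rw [smul_sub, ← map_smul, ← hy, map_sub, d₂_d₃, sub_zero, h₁, sub_self]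
  exact sub_eq_zero.mp ((smul_eq_zero.mp this).resolve_left ha)


lemma exists_lift {M L F : Type} [AddCommGroup M] [Module R M] [AddCommGroup L] [Module R L]
    [AddCommGroup F] [Module R F] [Module.Projective R F] (f : L →ₗ[R] M) (h : F →ₗ[R] M)
    (H : ∀ x, ∃ y, f y = h x) : ∃ l : F →ₗ[R] L, ∀ x, f (l x) = h x := by
  obtain ⟨l, hl⟩ := Module.projective_lifting_property f.rangeRestrict
    (h.codRestrict (LinearMap.range f) H) f.surjective_rangeRestrict
  exact ⟨l, fun x => congrArg Subtype.val (LinearMap.congr_fun hl x)⟩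

/-- Coordinatewise multiplication by the `r`-th powers of the generators. -/
def scale (r : ℕ) : Mid R N →ₗ[R] Mid R N where
  toFun z := (fun i => γ X i ^ r * z.1 i, fun j => g X j ^ r * z.2 j)
  map_add' x y := by ext <;> simp [mul_add]
  map_smul' c x := by ext <;> simp [mul_left_comm]

lemma d₁_scale {Y : Matrix (Fin (N + 2)) (Fin (N + 1)) R} {r : ℕ}
    (hγ : ∀ i, γ Y i = γ X i ^ (r + 1)) (hg : ∀ j, g Y j = g X j ^ (r + 1)) (z : Mid R N) :
    d₁ X (scale X r z) = d₁ Y z := by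
  simp only [d₁_apply, scale, dotProduct, hγ, hg, LinearMap.coe_mk, AddHom.coe_mk]
  congr 1 <;> refine Finset.sum_congr rfl fun i _ => by ring

lemma g_dotProduct_d₂ (y : Mid R N) : g X ⬝ᵥ (d₂ X y).2 =
    (g X ⬝ᵥ ult X) * (penult X ⬝ᵥ y.2) - (g X ⬝ᵥ penult X) * (ult X ⬝ᵥ y.2) := by
  rw [d₂_apply, dotProduct_add, dotProduct_comm _ (_ ᵥ* _), ← dotProduct_mulVec, top_mulVec_g,
    dotProduct_zero, zero_add, dotProduct_sub, dotProduct_smul, dotProduct_smul, smul_eq_mul,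
    smul_eq_mul]
  ring

/-- A lift of the projection between quotients by consecutive Frobenius powers of the ideal to
the resolutions, given by an explicit scalar in degree three. -/
lemma exists_chainMap [IsDomain R] {Y : Matrix (Fin (N + 2)) (Fin (N + 1)) R} {r : ℕ}
    (hγ : ∀ i, γ Y i = γ X i ^ (r + 1)) (hg : ∀ j, g Y j = g X j ^ (r + 1))
    (ha : g Y ⬝ᵥ penult Y = (g X ⬝ᵥ penult X) ^ (r + 1))
    (hb : g Y ⬝ᵥ ult Y = (g X ⬝ᵥ ult X) ^ (r + 1))
    (h1 : ∀ z, d₁ X z = 0 → ∃ y, d₂ X y = z) (h2 : ∀ z, d₂ X z = 0 → ∃ y, d₃ X y = z)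
    (h0 : g X ⬝ᵥ penult X ≠ 0) (hreg : RegPair (g X ⬝ᵥ penult X) (g X ⬝ᵥ ult X)) :
    ∃ φ : Mid R N →ₗ[R] Mid R N, (∀ y, d₂ X (φ y) = scale X r (d₂ Y y)) ∧
      ∀ h, φ (d₃ Y h) = d₃ X (((g X ⬝ᵥ penult X) * (g X ⬝ᵥ ult X)) ^ r * h) := by
  obtain ⟨φ, hφ⟩ := exists_lift (d₂ X) (scale X r ∘ₗ d₂ Y) fun y => h1 _ (by
    rw [LinearMap.comp_apply, d₁_scale X hγ hg, d₁_d₂])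
  set a := g X ⬝ᵥ penult X
  set b := g X ⬝ᵥ ult X
  let pr (v : Fin (N + 1) → R) : Mid R N →ₗ[R] R :=
    { toFun := fun y => v ⬝ᵥ y.2
      map_add' := fun x y => by simp
      map_smul' := fun c x => by simp }
  let B : Mid R N →ₗ[R] R × R := LinearMap.prod
    (pr (penult X) ∘ₗ φ - b ^ r • pr (penult Y)) (pr (ult X) ∘ₗ φ - a ^ r • pr (ult Y))
  have hB : ∀ y, B y = (penult X ⬝ᵥ (φ y).2 - b ^ r * (penult Y ⬝ᵥ y.2),
      ult X ⬝ᵥ (φ y).2 - a ^ r * (ult Y ⬝ᵥ y.2)) := fun y => rfl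
  obtain ⟨s, hs⟩ := exists_lift
    (LinearMap.prod (a • LinearMap.id) (b • LinearMap.id) : R →ₗ[R] R × R) B fun y => by
    have e1 := g_dotProduct_d₂ X (φ y)
    have e2 := g_dotProduct_d₂ Y y
    have e3 : g X ⬝ᵥ (d₂ X (φ y)).2 = g Y ⬝ᵥ (d₂ Y y).2 := by
      rw [hφ]
      simp only [LinearMap.comp_apply, scale, dotProduct, hg, LinearMap.coe_mk, AddHom.coe_mk]
      refine Finset.sum_congr rfl fun i _ => by ring
    rw [e1, e2, ha, hb] at e3
    obtain ⟨c, hc, hc'⟩ := hreg (ult X ⬝ᵥ (φ y).2 - a ^ r * (ult Y ⬝ᵥ y.2))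
      (penult X ⬝ᵥ (φ y).2 - b ^ r * (penult Y ⬝ᵥ y.2)) (by linear_combination -e3)
    refine ⟨c, ?_⟩
    rw [hB, hc, hc']
    simp [mul_comm]
  refine ⟨φ - d₃ X ∘ₗ s, fun y => ?_, fun h => ?_⟩
  · rw [LinearMap.sub_apply, map_sub, LinearMap.comp_apply, d₂_d₃, sub_zero, hφ]; rfl
  · have e0 : d₂ X ((φ - d₃ X ∘ₗ s) (d₃ Y h)) = 0 := by
      rw [LinearMap.sub_apply, map_sub, LinearMap.comp_apply, d₂_d₃, sub_zero, hφ,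
        LinearMap.comp_apply, d₂_d₃, map_zero]
    obtain ⟨c, hc⟩ := h2 _ e0
    rw [← hc]
    congr 1
    have hs' : a * s (d₃ Y h) = penult X ⬝ᵥ (φ (d₃ Y h)).2 - b ^ r * (penult Y ⬝ᵥ (d₃ Y h).2) :=
      congrArg Prod.fst (hs (d₃ Y h))
    have e1 : c * a = b ^ r * (penult Y ⬝ᵥ (d₃ Y h).2) := by
      have : penult X ⬝ᵥ (d₃ X c).2 = c * a := by
        rw [d₃_apply, dotProduct_smul, dotProduct_comm, smul_eq_mul]
      rw [← this, hc, LinearMap.sub_apply, Prod.snd_sub, dotProduct_sub, LinearMap.comp_apply,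
        d₃_apply X, dotProduct_smul, dotProduct_comm _ (g X), smul_eq_mul]
      linear_combination -hs'
    rw [d₃_apply, dotProduct_smul, dotProduct_comm, ha, smul_eq_mul] at e1
    refine mul_right_cancel₀ h0 ?_
    rw [e1]; ring

end Algebra

section Regular

open RingTheory.Sequence

variable {R : Type} [CommRing R]

lemma isWeaklyRegular_concat_iff (l : List R) (x : R) :
    IsWeaklyRegular R (l ++ [x]) ↔
      IsWeaklyRegular R l ∧ ∀ y, x * y ∈ Ideal.ofList l → y ∈ Ideal.ofList l := by
  rw [isWeaklyRegular_append_iff, isWeaklyRegular_singleton_iff,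
    isSMulRegular_quotient_iff_mem_of_smul_mem]
  simp

lemma RegPair.of_isWeaklyRegular {a b : R} (ha : IsSMulRegular R a)
    (h : IsWeaklyRegular R [a, b]) : RegPair a b := by
  intro x y e
  have := ((isWeaklyRegular_concat_iff [a] b).mp h).2 y (by
    rw [Ideal.ofList_singleton, Ideal.mem_span_singleton']
    exact ⟨x, by rw [e, mul_comm]⟩)
  rw [Ideal.ofList_singleton, Ideal.mem_span_singleton'] at this
  obtain ⟨c, rfl⟩ := this
  refine ⟨c, ha ?_, rfl⟩
  simp only [smul_eq_mul]
  linear_combination e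

lemma KoszulTriple.of_isWeaklyRegular {a b c : R} (ha : IsSMulRegular R a)
    (h : IsWeaklyRegular R [a, b, c]) : KoszulTriple a b c := by
  intro x y z e
  have h' := (isWeaklyRegular_concat_iff [a, b] c).mp h
  have := h'.2 z (by
    rw [Ideal.ofList_cons, Ideal.ofList_singleton, Ideal.mem_span_singleton_sup]
    exact ⟨-x, -y * b, Ideal.mem_span_singleton'.mpr ⟨-y, rfl⟩, by linear_combination -e⟩)
  rw [Ideal.ofList_cons, Ideal.ofList_singleton, Ideal.mem_span_singleton_sup] at this
  obtain ⟨s, r', hr, hs⟩ := this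
  obtain ⟨r, rfl⟩ := Ideal.mem_span_singleton'.mp hr
  obtain ⟨t, ht, ht'⟩ := RegPair.of_isWeaklyRegular ha h'.1 (x + s * c) (-(y + r * c))
    (by linear_combination e + c * hs)
  exact ⟨-r, s, t, by linear_combination ht, by linear_combination -ht', by linear_combination -hs⟩

end Regular

section Monomials

variable {σ k : Type} [Field k]

open MvPowerSeries

/-- The ideal generated by the monomials with exponents in a list. -/
noncomputable def monIdeal (k : Type) [Field k] (L : List (σ →₀ ℕ)) : Ideal (MvPowerSeries σ k) :=
  Ideal.ofList (L.map fun e => monomial e (1 : k))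

lemma exists_le_of_mem_monIdeal {L : List (σ →₀ ℕ)} {f : MvPowerSeries σ k}
    (hf : f ∈ monIdeal k L) {d : σ →₀ ℕ} (hd : coeff d f ≠ 0) : ∃ e ∈ L, e ≤ d := by
  classical
  induction hf using Submodule.span_induction generalizing d with
  | mem x hx =>
    obtain ⟨e, he, rfl⟩ := List.mem_map.mp hx
    rw [coeff_monomial] at hd
    exact ⟨e, he, by split_ifs at hd with h; exacts [h.ge, absurd rfl hd]⟩
  | zero => simp at hd
  | add x y _ _ hx hy =>
    rw [map_add] at hd
    by_cases h : coeff d x = 0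
    · exact hy (by simpa [h] using hd)
    · exact hx h
  | smul a x _ hx =>
    rw [smul_eq_mul, coeff_mul] at hd
    obtain ⟨⟨u, v⟩, huv, h⟩ := Finset.exists_ne_zero_of_sum_ne_zero hd
    obtain ⟨e, he, hev⟩ := hx (right_ne_zero_of_mul h)
    replace huv := Finset.HasAntidiagonal.mem_antidiagonal.mp huv
    exact ⟨e, he, hev.trans (huv ▸ le_add_self)⟩

lemma mem_monIdeal {L : List (σ →₀ ℕ)} {f : MvPowerSeries σ k}
    (H : ∀ d, coeff d f ≠ 0 → ∃ e ∈ L, e ≤ d) : f ∈ monIdeal k L := by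
  classical
  induction L generalizing f with
  | nil =>
    have : f = 0 := by
      ext d
      by_contra h
      simpa using H d h
    rw [this]; exact zero_mem _
  | cons e L ih =>
    rw [monIdeal, List.map_cons, Ideal.ofList_cons, Ideal.mem_span_singleton_sup]
    let q : MvPowerSeries σ k := fun d => coeff (d + e) f
    refine ⟨q, f - q * monomial e 1, ih fun d hd => ?_, by ring⟩
    rw [map_sub, coeff_mul_monomial] at hd
    split_ifs at hd with h
    · exact absurd (by
        change coeff d f - coeff (d - e + e) f * 1 = 0
        rw [tsub_add_cancel_of_le h]; ring) hd
    · obtain ⟨e', he', h'⟩ := H d (by simpa using hd)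
      rcases List.mem_cons.mp he' with rfl | he'
      · exact absurd h' h
      · exact ⟨e', he', h'⟩

/-- The ideal generated by a set of variables. -/
noncomputable def varIdeal (k : Type) [Field k] (B : Set σ) : Ideal (MvPowerSeries σ k) :=
  Ideal.span (MvPowerSeries.X '' B)

lemma exists_mem_of_mem_varIdeal {B : Set σ} {f : MvPowerSeries σ k}
    (hf : f ∈ varIdeal k B) {d : σ →₀ ℕ} (hd : coeff d f ≠ 0) : ∃ v ∈ B, d v ≠ 0 := by
  classical
  induction hf using Submodule.span_induction generalizing d with
  | mem x hx =>
    obtain ⟨v, hv, rfl⟩ := hx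
    rw [coeff_X] at hd
    exact ⟨v, hv, by split_ifs at hd with h; exacts [by simp [h], absurd rfl hd]⟩
  | zero => simp at hd
  | add x y _ _ hx hy =>
    rw [map_add] at hd
    by_cases h : coeff d x = 0
    · exact hy (by simpa [h] using hd)
    · exact hx h
  | smul a x _ hx =>
    rw [smul_eq_mul, coeff_mul] at hd
    obtain ⟨⟨u, v⟩, huv, h⟩ := Finset.exists_ne_zero_of_sum_ne_zero hd
    obtain ⟨w, hw, hwv⟩ := hx (right_ne_zero_of_mul h)
    replace huv := Finset.HasAntidiagonal.mem_antidiagonal.mp huv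
    exact ⟨w, hw, by rw [← huv]; simp [hwv]⟩

/-- Exponents with disjoint supports. -/
def Coprime (e μ : σ →₀ ℕ) : Prop := ∀ x, e x = 0 ∨ μ x = 0

lemma Coprime.le {e μ d : σ →₀ ℕ} (h : Coprime e μ) (H : e ≤ μ + d) : e ≤ d := fun x => by
  rcases h x with h | h
  · simp [h]
  · simpa [h] using H x

/-- A power series that is a monomial modulo some variables not dividing that monomial is a
nonzerodivisor modulo every ideal generated by monomials coprime to it. -/
lemma mem_monIdeal_of_mul_mem [Finite σ] {L : List (σ →₀ ℕ)} {μ : σ →₀ ℕ} {c : k} (hc : c ≠ 0)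
    (hL : ∀ e ∈ L, Coprime e μ) {B : Set σ} (hB : ∀ v ∈ B, μ v = 0) {D y : MvPowerSeries σ k}
    (hD : D - monomial μ c ∈ varIdeal k B) (h : D * y ∈ monIdeal k L) : y ∈ monIdeal k L := by
  classical
  have := Fintype.ofFinite σ
  let ω (a : σ →₀ ℕ) : ℕ := ∑ v, if v ∈ B then a v else 0
  have hω : ∀ a b, ω (a + b) = ω a + ω b := fun a b => by
    simp only [ω, ← Finset.sum_add_distrib]
    refine Finset.sum_congr rfl fun v _ => ?_
    split_ifs <;> simp
  have hμ : ω μ = 0 := Finset.sum_eq_zero fun v _ => by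
    split_ifs with hv
    exacts [hB v hv, rfl]
  have hDμ : coeff μ D = c := by
    by_contra hne
    obtain ⟨v, hv, h'⟩ := exists_mem_of_mem_varIdeal hD (d := μ) (by
      rw [map_sub, coeff_monomial_same]; exact sub_ne_zero.mpr hne)
    exact h' (hB v hv)
  have hDa : ∀ a, a ≠ μ → coeff a D ≠ 0 → 0 < ω a := fun a ha ha' => by
    obtain ⟨v, hv, h'⟩ := exists_mem_of_mem_varIdeal hD (d := a) (by
      rw [map_sub, coeff_monomial_ne ha, sub_zero]; exact ha')
    refine Finset.sum_pos' (fun _ _ => Nat.zero_le _) ⟨v, Finset.mem_univ v, ?_⟩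
    rw [if_pos hv]; exact Nat.pos_of_ne_zero h'
  refine mem_monIdeal ?_
  suffices H : ∀ n d, ω d = n → coeff d y ≠ 0 → ∃ e ∈ L, e ≤ d from fun d => H _ d rfl
  intro n
  induction n using Nat.strong_induction_on with
  | _ n ih =>
    rintro d rfl hd
    by_contra hno
    have key : coeff (μ + d) (D * y) = c * coeff d y := by
      rw [coeff_mul, Finset.sum_eq_single (μ, d), hDμ]
      · rintro ⟨a, b⟩ hab hne
        replace hab := Finset.HasAntidiagonal.mem_antidiagonal.mp hab
        dsimp only at hab ⊢
        by_contra hz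
        have ha := left_ne_zero_of_mul hz
        have haμ : a ≠ μ := fun h' => hne (by
          subst h'; rw [add_left_cancel hab])
        have h1 := hDa a haμ ha
        have h2 : ω a + ω b = ω d := by rw [← hω, hab, hω, hμ, zero_add]
        obtain ⟨e, he, heb⟩ := ih (ω b) (by omega) b rfl (right_ne_zero_of_mul hz)
        exact hno ⟨e, he, (hL e he).le (heb.trans (hab ▸ le_add_self))⟩
      · intro hn; simp at hn
    obtain ⟨e, he, h'⟩ := exists_le_of_mem_monIdeal h (d := μ + d)
      (key ▸ mul_ne_zero hc hd)
    exact hno ⟨e, he, (hL e he).le h'⟩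

end Monomials

section Triangular

variable {σ k : Type} [Field k]

open MvPowerSeries RingTheory.Sequence

lemma det_sub_prod_mem_of_lower {R : Type} [CommRing R] {n : ℕ} {M : Matrix (Fin n) (Fin n) R}
    {K : Ideal R} (h : ∀ i j, i < j → M i j ∈ K) : M.det - ∏ i, M i i ∈ K := by
  rw [← Ideal.Quotient.eq, RingHom.map_det, map_prod, det_of_isLowerTriangular]
  · rfl
  · intro i j hij
    exact Ideal.Quotient.eq_zero_iff_mem.mpr (h i j hij)

lemma det_sub_prod_mem_of_upper {R : Type} [CommRing R] {n : ℕ} {M : Matrix (Fin n) (Fin n) R}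
    {K : Ideal R} (h : ∀ i j, j < i → M i j ∈ K) : M.det - ∏ i, M i i ∈ K := by
  rw [← det_transpose]
  exact det_sub_prod_mem_of_lower fun i j hij => h j i hij

/-- `D` is a nonzero multiple of a monomial in the variables from `S`, up to terms divisible by
variables from `B`. -/
def MonMod (D : MvPowerSeries σ k) (S B : Set σ) : Prop :=
  ∃ (μ : σ →₀ ℕ) (c : k), c ≠ 0 ∧ (∀ v, μ v ≠ 0 → v ∈ S) ∧ D - monomial μ c ∈ varIdeal k B

lemma MonMod.pow {D : MvPowerSeries σ k} {S B : Set σ} (h : MonMod D S B) (r : ℕ) :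
    MonMod (D ^ r) S B := by
  obtain ⟨μ, c, hc, hS, hD⟩ := h
  refine ⟨r • μ, c ^ r, pow_ne_zero r hc, fun v hv => hS v fun h => hv (by simp [h]), ?_⟩
  rw [← monomial_pow]
  exact Ideal.mem_of_dvd _ (sub_dvd_pow_sub_pow _ _ r) hD

lemma MonMod.neg_one_pow_mul {D : MvPowerSeries σ k} {S B : Set σ} (h : MonMod D S B) (r : ℕ) :
    MonMod ((-1) ^ r * D) S B := by
  obtain ⟨μ, c, hc, hS, hD⟩ := h
  refine ⟨μ, (-1) ^ r * c, by simpa using hc, hS, ?_⟩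
  have : monomial μ ((-1) ^ r * c) = (-1) ^ r * monomial μ c := by
    rcases Nat.even_or_odd r with h | h <;> simp [h.neg_one_pow]
  rw [this, ← mul_sub]
  exact Ideal.mul_mem_left _ _ hD

lemma prod_X_eq_monomial {ι : Type} (s : Finset ι) (v : ι → σ) :
    ∏ i ∈ s, (MvPowerSeries.X (v i) : MvPowerSeries σ k) =
      monomial (∑ i ∈ s, Finsupp.single (v i) 1) 1 := by
  simp only [MvPowerSeries.X, prod_monomial, Finset.prod_const_one]

lemma MonMod.of_prod {n : ℕ} {D : MvPowerSeries σ k} {S B : Set σ} {v : Fin n → σ}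
    (hv : ∀ i, v i ∈ S) (h : D - ∏ i, MvPowerSeries.X (v i) ∈ varIdeal k B) : MonMod D S B := by
  classical
  refine ⟨∑ i, Finsupp.single (v i) 1, 1, one_ne_zero, fun w hw => ?_,
    prod_X_eq_monomial (k := k) _ v ▸ h⟩
  rw [Finsupp.finsetSum_apply] at hw
  obtain ⟨i, -, hi⟩ := Finset.exists_ne_zero_of_sum_ne_zero hw
  rw [Finsupp.single_apply] at hi
  split_ifs at hi with h
  exacts [h ▸ hv i, absurd rfl hi]

lemma X_mem_varIdeal {B : Set σ} {v : σ} (hv : v ∈ B) :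
    (MvPowerSeries.X v : MvPowerSeries σ k) ∈ varIdeal k B :=
  Ideal.subset_span ⟨v, hv, rfl⟩

lemma MonMod.det_of_lower {n : ℕ} {v : Fin n → Fin n → σ} {S B : Set σ} (hS : ∀ i, v i i ∈ S)
    (hB : ∀ i j, i < j → v i j ∈ B) :
    MonMod (Matrix.of fun i j => (MvPowerSeries.X (v i j) : MvPowerSeries σ k)).det S B :=
  .of_prod hS (det_sub_prod_mem_of_lower fun i j hij => X_mem_varIdeal (hB i j hij))

lemma MonMod.det_of_upper {n : ℕ} {v : Fin n → Fin n → σ} {S B : Set σ} (hS : ∀ i, v i i ∈ S)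
    (hB : ∀ i j, j < i → v i j ∈ B) :
    MonMod (Matrix.of fun i j => (MvPowerSeries.X (v i j) : MvPowerSeries σ k)).det S B :=
  .of_prod hS (det_sub_prod_mem_of_upper fun i j hij => X_mem_varIdeal (hB i j hij))

/-- A weakly regular sequence generating an ideal generated by monomials in variables from `T`. -/
def MonSeq (l : List (MvPowerSeries σ k)) (T : Set σ) : Prop :=
  IsWeaklyRegular (MvPowerSeries σ k) l ∧ ∃ L : List (σ →₀ ℕ), Ideal.ofList l = monIdeal k L ∧
    ∀ e ∈ L, ∀ v, e v ≠ 0 → v ∈ T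

lemma MonSeq.isWeaklyRegular_concat [Finite σ] {l : List (MvPowerSeries σ k)} {T S B : Set σ}
    {D : MvPowerSeries σ k} (hl : MonSeq l T) (hD : MonMod D S B) (hST : Disjoint S T)
    (hSB : Disjoint S B) : IsWeaklyRegular (MvPowerSeries σ k) (l ++ [D]) := by
  obtain ⟨hl, L, hL, hT⟩ := hl
  obtain ⟨μ, c, hc, hS, hD⟩ := hD
  refine (isWeaklyRegular_concat_iff l D).mpr ⟨hl, fun y hy => ?_⟩
  rw [hL] at hy ⊢
  refine mem_monIdeal_of_mul_mem hc (fun e he v => ?_) (fun v hv => ?_) hD hy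
  · by_contra! h
    exact hST.ne_of_mem (hS v h.2) (hT e he v h.1) rfl
  · by_contra! h
    exact hSB.ne_of_mem (hS v h) hv rfl

lemma MonSeq.concat [Finite σ] {l : List (MvPowerSeries σ k)} {T S B : Set σ}
    {D : MvPowerSeries σ k} (hl : MonSeq l T) (hD : MonMod D S B) (hST : Disjoint S T)
    (hSB : Disjoint S B) (hB : ∀ v ∈ B, MvPowerSeries.X v ∈ l) : MonSeq (l ++ [D]) (T ∪ S) := by
  refine ⟨hl.isWeaklyRegular_concat hD hST hSB, ?_⟩
  obtain ⟨hl, L, hL, hT⟩ := hl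
  obtain ⟨μ, c, hc, hS, hD⟩ := hD
  have hle : varIdeal k B ≤ Ideal.ofList l := Ideal.span_le.mpr (by
    rintro _ ⟨v, hv, rfl⟩
    exact Ideal.subset_span (hB v hv))
  refine ⟨L ++ [μ], ?_, fun e he v hv => ?_⟩
  · have hm : Ideal.span {monomial μ c} = Ideal.span {(monomial μ 1 : MvPowerSeries σ k)} := by
      have : monomial μ c = monomial 0 c * (monomial μ 1 : MvPowerSeries σ k) := by
        rw [monomial_mul_monomial, zero_add, mul_one]
      rw [this]
      exact Ideal.span_singleton_mul_left_unit
        ((isUnit_iff_constantCoeff).mpr (by simpa using hc)) _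
    rw [monIdeal, List.map_append, Ideal.ofList_append, Ideal.ofList_append, hL, ← monIdeal,
      List.map_singleton, Ideal.ofList_singleton, Ideal.ofList_singleton, ← hm, ← hL]
    refine le_antisymm (sup_le le_sup_left ?_) (sup_le le_sup_left ?_) <;>
      rw [Ideal.span_singleton_le_iff_mem]
    · rw [← sub_add_cancel D (monomial μ c)]
      exact add_mem (Ideal.mem_sup_left (hle hD))
        (Ideal.mem_sup_right (Ideal.mem_span_singleton_self _))
    · rw [← sub_sub_cancel D (monomial μ c)]
      exact sub_mem (Ideal.mem_sup_right (Ideal.mem_span_singleton_self _))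
        (Ideal.mem_sup_left (hle hD))
  · rcases List.mem_append.mp he with he | he
    · exact Or.inl (hT e he v hv)
    · exact Or.inr (hS v (List.mem_singleton.mp he ▸ hv))

lemma MonMod.X (v : σ) : MonMod (MvPowerSeries.X v : MvPowerSeries σ k) {v} ∅ :=
  .of_prod (n := 1) (v := fun _ => v) (fun _ => rfl) (by simp)

lemma exists_monSeq_X [Finite σ] (T : Set σ) : ∃ l : List (MvPowerSeries σ k), MonSeq l T ∧
    (∀ v ∈ T, MvPowerSeries.X v ∈ l) ∧ ∀ x ∈ l, constantCoeff x = 0 := by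
  induction T, T.toFinite using Set.Finite.induction_on with
  | empty =>
    exact ⟨[], ⟨.nil _ _, [], rfl, by simp⟩, by simp, by simp⟩
  | @insert a s ha _ ih =>
    obtain ⟨l, hl, h1, h2⟩ := ih
    refine ⟨l ++ [MvPowerSeries.X a], ?_, fun v hv => ?_, fun x hx => ?_⟩
    · rw [Set.insert_eq, Set.union_comm]
      exact hl.concat (.X a) (by simpa using ha) (by simp) (by simp)
    · rcases hv with rfl | hv
      · simp
      · simp [h1 v hv]
    · rcases List.mem_append.mp hx with hx | hx
      · exact h2 x hx
      · simp [List.mem_singleton.mp hx]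

lemma isWeaklyRegular_of_perm_append [Finite σ] {l l' l'' : List (MvPowerSeries σ k)}
    (h : IsWeaklyRegular (MvPowerSeries σ k) (l ++ l')) (hp : List.Perm l' l'')
    (hl : ∀ x ∈ l, constantCoeff x = 0) (hl' : ∀ x ∈ l', constantCoeff x = 0) :
    IsWeaklyRegular (MvPowerSeries σ k) l'' := by
  have := IsLocalRing.isWeaklyRegular_of_perm_of_subset_maximalIdeal h
    (rs' := l'' ++ l) ((hp.append_left l).trans List.perm_append_comm) fun r hr => by
      rw [IsLocalRing.mem_maximalIdeal, mem_nonunits_iff, isUnit_iff_constantCoeff,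
        isUnit_iff_ne_zero, not_not]
      rcases List.mem_append.mp hr with h | h
      exacts [hl r h, hl' r h]
  exact ((isWeaklyRegular_append_iff _ _ _).mp this).1

end Triangular

section Generic

variable (k : Type) [Field k] (N : ℕ)

open MvPowerSeries RingTheory.Sequence

/-- The generic matrix. -/
noncomputable def gen : Matrix (Fin (N + 2)) (Fin (N + 1))
    (MvPowerSeries (Fin (N + 2) × Fin (N + 1)) k) :=
  Matrix.of fun i j => MvPowerSeries.X (i, j)

variable {k} in
lemma constantCoeff_det_X {σ : Type} {n : ℕ} [NeZero n] (v : Fin n → Fin n → σ) :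
    constantCoeff (Matrix.of fun i j => (MvPowerSeries.X (v i j) : MvPowerSeries σ k)).det = 0 := by
  rw [RingHom.map_det]
  refine det_eq_zero_of_row_eq_zero 0 fun j => ?_
  simp

lemma g_gen (j : Fin (N + 1)) : g (gen k N) j = (-1) ^ (j : ℕ) *
    (Matrix.of fun r c : Fin N => (MvPowerSeries.X (Fin.castAdd 2 r, j.succAbove c) :
      MvPowerSeries (Fin (N + 2) × Fin (N + 1)) k)).det := rfl

lemma bigMinor_gen (i : Fin (N + 2)) : bigMinor (gen k N) i =
    (Matrix.of fun r c : Fin (N + 1) => (MvPowerSeries.X (i.succAbove r, c) :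
      MvPowerSeries (Fin (N + 2) × Fin (N + 1)) k)).det := rfl

lemma constantCoeff_g_gen [NeZero N] (j : Fin (N + 1)) : constantCoeff (g (gen k N) j) = 0 := by
  rw [g_gen, map_mul, constantCoeff_det_X, mul_zero]

lemma constantCoeff_bigMinor_gen (i : Fin (N + 2)) :
    constantCoeff (bigMinor (gen k N) i) = 0 := by
  rw [bigMinor_gen, constantCoeff_det_X]

lemma monMod_g_last : MonMod (g (gen k N) (Fin.last N)) {v | v.1.val = v.2.val}
    {v | v.1.val < v.2.val} := by
  rw [g_gen]
  refine (MonMod.det_of_lower (fun i => ?_) fun i j hij => ?_).neg_one_pow_mul _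
  · simp
  · simpa using hij

lemma monMod_g_zero : MonMod (g (gen k N) 0) {v | v.1.val + 1 = v.2.val}
    {v | v.1.val + 1 < v.2.val} := by
  rw [g_gen]
  refine (MonMod.det_of_lower (fun i => ?_) fun i j hij => ?_).neg_one_pow_mul _
  · simp
  · simpa using hij

lemma monMod_γ_zero [NeZero N] : MonMod (γ (gen k N) 0) {v | v.1.val = v.2.val + 1}
    {v | v.2.val + 1 < v.1.val} := by
  have h0 : Fin.castAdd 2 (0 : Fin N) = 0 := rfl
  rw [γ, bigMinor_gen, h0]
  refine (MonMod.det_of_upper (fun i => ?_) fun i j hij => ?_).neg_one_pow_mul _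
  · simp
  · simpa using hij

lemma neg_one_pow_mul_bigMinor_last {R : Type} [CommRing R]
    (X : Matrix (Fin (N + 2)) (Fin (N + 1)) R) :
    g X ⬝ᵥ penult X = (-1) ^ N * bigMinor X (Fin.last _) := by
  rw [bigMinor_last, ← mul_assoc, ← mul_pow]; simp

lemma neg_one_pow_mul_bigMinor_penult {R : Type} [CommRing R]
    (X : Matrix (Fin (N + 2)) (Fin (N + 1)) R) :
    g X ⬝ᵥ ult X = (-1) ^ N * bigMinor X (Fin.last N).castSucc := by
  rw [bigMinor_penult, ← mul_assoc, ← mul_pow]; simp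

lemma monMod_penult : MonMod (g (gen k N) ⬝ᵥ penult (gen k N)) {v | v.1.val = v.2.val}
    {v | v.1.val < v.2.val} := by
  rw [neg_one_pow_mul_bigMinor_last, bigMinor_gen]
  refine (MonMod.det_of_lower (fun i => ?_) fun i j hij => ?_).neg_one_pow_mul _
  · simp
  · simpa using hij

lemma monMod_ult : MonMod (g (gen k N) ⬝ᵥ ult (gen k N))
    {v | v.1.val + 1 = v.2.val ∨ v.1.val = N + 1 ∧ v.2.val = 0}
    {v | v.1.val + 1 < v.2.val ∨ v.1.val = N + 1 ∧ 0 < v.2.val} := by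
  have h : frame (gen k N) (ult (gen k N)) = Matrix.of fun r c : Fin (N + 1) =>
      MvPowerSeries.X ((Fin.cons (Fin.last (N + 1)) (Fin.castAdd 2) : Fin (N + 1) → Fin (N + 2)) r,
        c) := by
    ext1 i j
    refine Fin.cases ?_ (fun i => ?_) i <;> rfl
  rw [← det_frame, h]
  refine MonMod.det_of_lower (fun i => ?_) fun i j hij => ?_
  · refine Fin.cases ?_ (fun i => ?_) i <;> simp
  · revert hij
    refine Fin.cases ?_ (fun i => ?_) i
    · intro hij
      right
      simpa using hij
    · intro hij
      left
      simpa [Fin.lt_def] using hij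

/-- The three minors used to cut out the ideal form a regular sequence after raising to powers. -/
lemma isWeaklyRegular_minors [NeZero N] {r : ℕ} (hr : r ≠ 0)
    {l : List (MvPowerSeries (Fin (N + 2) × Fin (N + 1)) k)}
    (hl : List.Perm [g (gen k N) 0 ^ r, γ (gen k N) 0 ^ r, g (gen k N) (Fin.last N) ^ r] l) :
    IsWeaklyRegular (MvPowerSeries (Fin (N + 2) × Fin (N + 1)) k) l := by
  obtain ⟨Z, hZ, h1, h2⟩ := exists_monSeq_X (k := k)
    {v : Fin (N + 2) × Fin (N + 1) | v.1.val + 1 < v.2.val ∨ v.2.val + 1 < v.1.val}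
  have h3 := hZ.concat ((monMod_g_zero k N).pow r)
    (Set.disjoint_left.mpr fun v hv hv' => by simp only [Set.mem_ofPred_eq] at hv hv'; omega)
    (Set.disjoint_left.mpr fun v hv hv' => by simp only [Set.mem_ofPred_eq] at hv hv'; omega)
    fun v hv => h1 v (Or.inl hv)
  have h4 := h3.concat ((monMod_γ_zero k N).pow r)
    (Set.disjoint_left.mpr fun v hv hv' => by
      simp only [Set.mem_ofPred_eq, Set.mem_union] at hv hv'; omega)
    (Set.disjoint_left.mpr fun v hv hv' => by simp only [Set.mem_ofPred_eq] at hv hv'; omega)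
    fun v hv => List.mem_append_left _ (h1 v (Or.inr hv))
  have h5 := h4.isWeaklyRegular_concat ((monMod_g_last k N).pow r)
    (Set.disjoint_left.mpr fun v hv hv' => by
      simp only [Set.mem_ofPred_eq, Set.mem_union] at hv hv'; omega)
    (Set.disjoint_left.mpr fun v hv hv' => by simp only [Set.mem_ofPred_eq] at hv hv'; omega)
  refine isWeaklyRegular_of_perm_append (l := Z) (by simpa using h5) hl h2 fun x hx => ?_
  simp only [List.mem_cons, List.not_mem_nil, or_false] at hx
  rcases hx with rfl | rfl | rfl <;> rw [map_pow]
  · rw [constantCoeff_g_gen, zero_pow hr]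
  · rw [γ, map_mul, constantCoeff_bigMinor_gen, mul_zero, zero_pow hr]
  · rw [constantCoeff_g_gen, zero_pow hr]

lemma isWeaklyRegular_last_minors {r : ℕ} (hr : r ≠ 0) :
    IsWeaklyRegular (MvPowerSeries (Fin (N + 2) × Fin (N + 1)) k)
      [(g (gen k N) ⬝ᵥ penult (gen k N)) ^ r, (g (gen k N) ⬝ᵥ ult (gen k N)) ^ r] := by
  obtain ⟨Z, hZ, h1, h2⟩ := exists_monSeq_X (k := k)
    {v : Fin (N + 2) × Fin (N + 1) | v.1.val + 1 < v.2.val ∨ v.1.val = N + 1 ∧ 0 < v.2.val}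
  have h3 := hZ.concat ((monMod_ult k N).pow r)
    (Set.disjoint_left.mpr fun v hv hv' => by simp only [Set.mem_ofPred_eq] at hv hv'; omega)
    (Set.disjoint_left.mpr fun v hv hv' => by simp only [Set.mem_ofPred_eq] at hv hv'; omega)
    fun v hv => h1 v hv
  have h4 := h3.isWeaklyRegular_concat ((monMod_penult k N).pow r)
    (Set.disjoint_left.mpr fun v hv hv' => by
      have := v.2.isLt
      simp only [Set.mem_ofPred_eq, Set.mem_union] at hv hv'; omega)
    (Set.disjoint_left.mpr fun v hv hv' => by simp only [Set.mem_ofPred_eq] at hv hv'; omega)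
  refine isWeaklyRegular_of_perm_append (l := Z) (by simpa using h4) (List.Perm.swap _ _ _) h2
    fun x hx => ?_
  simp only [List.mem_cons, List.not_mem_nil, or_false] at hx
  rcases hx with rfl | rfl <;> rw [map_pow]
  · rw [neg_one_pow_mul_bigMinor_penult, map_mul, constantCoeff_bigMinor_gen, mul_zero, zero_pow hr]
  · rw [neg_one_pow_mul_bigMinor_last, map_mul, constantCoeff_bigMinor_gen, mul_zero, zero_pow hr]

end Generic

section Map

variable {R S : Type} [CommRing R] [CommRing S] {N : ℕ} (f : R →+* S)
  (X : Matrix (Fin (N + 2)) (Fin (N + 1)) R)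

lemma bigMinor_map (i : Fin (N + 2)) : bigMinor (X.map f) i = f (bigMinor X i) := by
  rw [bigMinor, bigMinor, RingHom.map_det]; rfl

lemma g_map (j : Fin (N + 1)) : g (X.map f) j = f (g X j) := by
  rw [g, g, map_mul, RingHom.map_det, map_pow, map_neg, map_one]; rfl

lemma γ_map (i : Fin N) : γ (X.map f) i = f (γ X i) := by
  rw [γ, γ, map_mul, bigMinor_map, map_pow, map_neg, map_one]

lemma g_dotProduct_penult_map :
    g (X.map f) ⬝ᵥ penult (X.map f) = f (g X ⬝ᵥ penult X) := by
  simp only [dotProduct, g_map, map_sum, map_mul]; rfl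

lemma g_dotProduct_ult_map : g (X.map f) ⬝ᵥ ult (X.map f) = f (g X ⬝ᵥ ult X) := by
  simp only [dotProduct, g_map, map_sum, map_mul]; rfl

end Map

section Stage

open RingTheory.Sequence

variable (k : Type) [Field k] (N p : ℕ) [Fact p.Prime] [CharP k p]

instance (σ : Type) : CharP (MvPowerSeries σ k) p :=
  charP_of_injective_ringHom (f := (MvPowerSeries.C : k →+* MvPowerSeries σ k))
    (RingHom.injective _) p

instance (σ : Type) : IsDomain (MvPowerSeries σ k) := NoZeroDivisors.to_isDomain _

/-- The generic matrix with entries raised to the power `p ^ e`. -/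
noncomputable def genPow (e : ℕ) : Matrix (Fin (N + 2)) (Fin (N + 1))
    (MvPowerSeries (Fin (N + 2) × Fin (N + 1)) k) :=
  (gen k N).map (iterateFrobenius _ p e)

variable {N} (e : ℕ)

lemma g_genPow (j : Fin (N + 1)) : g (genPow k N p e) j = g (gen k N) j ^ p ^ e := by
  rw [genPow, g_map, iterateFrobenius_def]

lemma γ_genPow (i : Fin N) : γ (genPow k N p e) i = γ (gen k N) i ^ p ^ e := by
  rw [genPow, γ_map, iterateFrobenius_def]

lemma genPow_penult : g (genPow k N p e) ⬝ᵥ penult (genPow k N p e) =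
    (g (gen k N) ⬝ᵥ penult (gen k N)) ^ p ^ e := by
  rw [genPow, g_dotProduct_penult_map, iterateFrobenius_def]

lemma genPow_ult : g (genPow k N p e) ⬝ᵥ ult (genPow k N p e) =
    (g (gen k N) ⬝ᵥ ult (gen k N)) ^ p ^ e := by
  rw [genPow, g_dotProduct_ult_map, iterateFrobenius_def]

lemma ppow_ne_zero : p ^ e ≠ 0 := pow_ne_zero e (Fact.out : p.Prime).ne_zero

variable [NeZero N]

lemma ne_zero_of_isWeaklyRegular {R : Type} [CommRing R] [Nontrivial R] {a : R} {l : List R}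
    (h : IsWeaklyRegular R (a :: l)) : a ≠ 0 := by
  rintro rfl
  have := ((isWeaklyRegular_cons_iff R _ _).mp h).1
  exact one_ne_zero (this (by simp : (0 : R) • (1 : R) = (0 : R) • 0))

lemma g_last_genPow_ne_zero : g (genPow k N p e) (Fin.last N) ≠ 0 := by
  rw [g_genPow]
  exact ne_zero_of_isWeaklyRegular (isWeaklyRegular_minors k N (ppow_ne_zero p e)
    (List.perm_append_comm (l₁ := [_, _])))

lemma γ_zero_genPow_ne_zero : γ (genPow k N p e) 0 ≠ 0 := by
  rw [γ_genPow]
  exact ne_zero_of_isWeaklyRegular (isWeaklyRegular_minors k N (ppow_ne_zero p e)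
    (List.Perm.swap _ _ _))

lemma regPair_genPow : RegPair (g (genPow k N p e) 0) (g (genPow k N p e) (Fin.last N)) := by
  rw [g_genPow, g_genPow]
  have h := isWeaklyRegular_minors k N (ppow_ne_zero p e)
    ((List.Perm.swap _ _ []).cons _)
  exact .of_isWeaklyRegular ((isWeaklyRegular_cons_iff _ _ _).mp h).1
    ((isWeaklyRegular_append_iff _ [_, _] _).mp h).1

lemma exact_one_genPow {z : Mid (MvPowerSeries (Fin (N + 2) × Fin (N + 1)) k) N}
    (hz : d₁ (genPow k N p e) z = 0) : ∃ y, d₂ (genPow k N p e) y = z := by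
  have h := isWeaklyRegular_minors k N (mul_ne_zero (ppow_ne_zero p e) two_ne_zero)
    (List.Perm.refl _)
  simp only [pow_mul, ← g_genPow, ← γ_genPow] at h
  have h0 := ((isWeaklyRegular_cons_iff _ _ _).mp h).1
  refine ker_d₁ _ (g_last_genPow_ne_zero k p e) (regPair_genPow k p e)
    (ne_zero_of_isWeaklyRegular h)
    (.of_isWeaklyRegular h0 ((isWeaklyRegular_append_iff _ [_, _] _).mp h).1)
    (.of_isWeaklyRegular h0 h) (g_sq_smul_mem _ hz _)
    (bigMinor_sq_smul_mem _ (γ_zero_genPow_ne_zero k p e) hz) (g_sq_smul_mem _ hz _)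

lemma exact_two_genPow {z : Mid (MvPowerSeries (Fin (N + 2) × Fin (N + 1)) k) N}
    (hz : d₂ (genPow k N p e) z = 0) : ∃ y, d₃ (genPow k N p e) y = z :=
  ker_d₂ _ (g_last_genPow_ne_zero k p e) (regPair_genPow k p e) hz

/-- The minors `G_n` and `G_{n-1}` up to sign. -/
noncomputable def lastProd (k : Type) [Field k] (N : ℕ) :
    MvPowerSeries (Fin (N + 2) × Fin (N + 1)) k :=
  (g (gen k N) ⬝ᵥ penult (gen k N)) * (g (gen k N) ⬝ᵥ ult (gen k N))

lemma exists_chainMap_genPow : ∃ φ : Mid (MvPowerSeries (Fin (N + 2) × Fin (N + 1)) k) N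
    →ₗ[MvPowerSeries (Fin (N + 2) × Fin (N + 1)) k]
      Mid (MvPowerSeries (Fin (N + 2) × Fin (N + 1)) k) N,
    (∀ y, d₂ (genPow k N p e) (φ y) =
      scale (genPow k N p e) (p - 1) (d₂ (genPow k N p (e + 1)) y)) ∧
    ∀ h, φ (d₃ (genPow k N p (e + 1)) h) =
      d₃ (genPow k N p e) ((lastProd k N ^ (p - 1)) ^ p ^ e * h) := by
  have hp : p - 1 + 1 = p := Nat.sub_add_cancel (Fact.out : p.Prime).one_le
  have h := isWeaklyRegular_last_minors k N (ppow_ne_zero p e)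
  have hu : (lastProd k N ^ (p - 1)) ^ p ^ e =
      ((g (genPow k N p e) ⬝ᵥ penult (genPow k N p e)) *
        (g (genPow k N p e) ⬝ᵥ ult (genPow k N p e))) ^ (p - 1) := by
    rw [genPow_penult, genPow_ult, lastProd, ← mul_pow, pow_right_comm]
  simp only [hu]
  refine exists_chainMap (genPow k N p e) (fun i => ?_) (fun i => ?_) ?_ ?_
    (fun z => exact_one_genPow k p e) (fun z => exact_two_genPow k p e) ?_ ?_
  · rw [γ_genPow, γ_genPow, hp, ← pow_mul, ← pow_succ]
  · rw [g_genPow, g_genPow, hp, ← pow_mul, ← pow_succ]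
  · rw [genPow_penult, genPow_penult, hp, ← pow_mul, ← pow_succ]
  · rw [genPow_ult, genPow_ult, hp, ← pow_mul, ← pow_succ]
  · rw [genPow_penult]
    exact ne_zero_of_isWeaklyRegular h
  · rw [genPow_penult, genPow_ult]
    exact .of_isWeaklyRegular ((isWeaklyRegular_cons_iff _ _ _).mp h).1 h

end Stage

section TopExt

open CategoryTheory Limits Opposite

variable {R : Type} [CommRing R] {X X' : ModuleCat.{0} R} (P : ProjectiveResolution X)
  (P' : ProjectiveResolution X') (Y : ModuleCat.{0} R)

/-- The functor `Hom(-, Y)` to the opposite category. -/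
noncomputable abbrev homOp : ModuleCat.{0} R ⥤ (ModuleCat.{0} R)ᵒᵖ :=
  ((linearYoneda R (ModuleCat.{0} R)).obj Y).rightOp

/-- The complex `Hom(P, Y)` in the opposite category. -/
noncomputable abbrev homOpComplex : ChainComplex (ModuleCat.{0} R)ᵒᵖ ℕ :=
  ((homOp Y).mapHomologicalComplex _).obj P.complex

/-- The derived functor is computed by the projective resolution. -/
noncomputable def derivedIso :
    ((homOp Y).leftDerived 3).obj X ≅ (homOpComplex P Y).homology 3 :=
  P.isoLeftDerivedObj (homOp Y) 3

/-- In top degree three, the derived functor is the object of cycles. -/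
noncomputable def derivedIsoCycles (h : P.complex.d 4 3 = 0) :
    ((homOp Y).leftDerived 3).obj X ≅ (homOpComplex P Y).cycles 3 :=
  haveI := (homOpComplex P Y).isIso_homologyπ 4 3 (by simp)
    (show (homOp Y).map (P.complex.d 4 3) = 0 by rw [h, Functor.map_zero])
  derivedIso P Y ≪≫ (asIso ((homOpComplex P Y).homologyπ 3)).symm

lemma derivedIsoCycles_hom_homologyπ (h : P.complex.d 4 3 = 0) :
    (derivedIsoCycles P Y h).hom ≫ (homOpComplex P Y).homologyπ 3 = (derivedIso P Y).hom := by
  simp [derivedIsoCycles]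

lemma derivedIsoCycles_hom_naturality (h : P.complex.d 4 3 = 0) (h' : P'.complex.d 4 3 = 0)
    (f : X ⟶ X') (φ : P.complex ⟶ P'.complex) (comm : φ.f 0 ≫ P'.π.f 0 = P.π.f 0 ≫ f) :
    ((homOp Y).leftDerived 3).map f ≫ (derivedIsoCycles P' Y h').hom =
      (derivedIsoCycles P Y h).hom ≫
        HomologicalComplex.cyclesMap (((homOp Y).mapHomologicalComplex _).map φ) 3 := by
  have := (homOpComplex P' Y).isIso_homologyπ 4 3 (by simp)
    (show (homOp Y).map (P'.complex.d 4 3) = 0 by rw [h', Functor.map_zero])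
  rw [← cancel_mono ((homOpComplex P' Y).homologyπ 3), Category.assoc, Category.assoc,
    derivedIsoCycles_hom_homologyπ, ← HomologicalComplex.homologyπ_naturality, ← Category.assoc,
    derivedIsoCycles_hom_homologyπ]
  exact ProjectiveResolution.isoLeftDerivedObj_hom_naturality f P P' φ comm (homOp Y) 3

/-- The projection from the cochains in top degree three to the derived functor. -/
noncomputable def topProjUnop (h : P.complex.d 4 3 = 0) :
    ((homOpComplex P Y).X 3).unop ⟶ (((homOp Y).leftDerived 3).obj X).unop :=
  ((derivedIsoCycles P Y h).hom ≫ (homOpComplex P Y).iCycles 3).unop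

/-- The projection from the cochains in top degree three to `Ext³`. -/
noncomputable def topProj (h : P.complex.d 4 3 = 0) :
    (P.complex.X 3 ⟶ Y) →ₗ[R] ((Ext R (ModuleCat.{0} R) 3).obj (op X)).obj Y :=
  (topProjUnop P Y h).hom

lemma topProj_surjective (h : P.complex.d 4 3 = 0) : Function.Surjective (topProj P Y h) := by
  have : Epi (topProjUnop P Y h) := by
    unfold topProjUnop
    infer_instance
  exact (ModuleCat.epi_iff_surjective _).mp this

lemma topProj_eq_zero_iff (h : P.complex.d 4 3 = 0) (x : P.complex.X 3 ⟶ Y) :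
    topProj P Y h x = 0 ↔ ∃ y : P.complex.X 2 ⟶ Y, P.complex.d 3 2 ≫ y = x := by
  let S : ShortComplex (ModuleCat.{0} R)ᵒᵖ := ShortComplex.mk ((homOpComplex P Y).iCycles 3)
    ((homOpComplex P Y).d 3 2) ((homOpComplex P Y).iCycles_d 3 2)
  have hS : S.Exact := S.exact_of_f_is_kernel ((homOpComplex P Y).cyclesIsKernel 3 2 (by simp))
  have hS' := (ShortComplex.moduleCat_exact_iff _).mp hS.unop
  constructor
  · intro hx
    refine hS' x ?_
    refine (ModuleCat.mono_iff_injective (derivedIsoCycles P Y h).hom.unop).mp inferInstance ?_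
    exact Eq.trans hx (map_zero (derivedIsoCycles P Y h).hom.unop.hom).symm
  · rintro ⟨y, rfl⟩
    have hz : ((homOpComplex P Y).d 3 2).unop ≫ topProjUnop P Y h = 0 := by
      rw [topProjUnop, ← unop_comp, Category.assoc, HomologicalComplex.iCycles_d,
        comp_zero, unop_zero]
    exact congrArg (fun q => q.hom y) hz

lemma topProj_naturality (h : P.complex.d 4 3 = 0) (h' : P'.complex.d 4 3 = 0) (f : X ⟶ X')
    (φ : P.complex ⟶ P'.complex) (comm : φ.f 0 ≫ P'.π.f 0 = P.π.f 0 ≫ f)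
    (x : P'.complex.X 3 ⟶ Y) :
    (((Ext R (ModuleCat.{0} R) 3).map f.op).app Y).hom (topProj P' Y h' x) =
      topProj P Y h (φ.f 3 ≫ x) := by
  have hz : topProjUnop P' Y h' ≫ (((homOp Y).leftDerived 3).map f).unop =
      ((((homOp Y).mapHomologicalComplex _).map φ).f 3).unop ≫ topProjUnop P Y h := by
    rw [topProjUnop, topProjUnop, ← unop_comp, ← unop_comp, ← Category.assoc,
      derivedIsoCycles_hom_naturality P P' Y h h' f φ comm, Category.assoc, Category.assoc,
      HomologicalComplex.cyclesMap_i]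
  exact congrArg (fun q => q.hom x) hz

end TopExt

section Resolution

open CategoryTheory Limits Opposite

/-- An exact sequence `0 → R → M → M → R` whose cokernel is `R ⧸ a`. -/
structure ExactSeq (R : Type) [CommRing R] (M : Type) [AddCommGroup M] [Module R M]
    (a : Ideal R) where
  /-- the last map -/
  δ₁ : M →ₗ[R] R
  /-- the middle map -/
  δ₂ : M →ₗ[R] M
  /-- the first map -/
  δ₃ : R →ₗ[R] M
  δ₁_δ₂ : ∀ y, δ₁ (δ₂ y) = 0
  δ₂_δ₃ : ∀ x, δ₂ (δ₃ x) = 0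
  mem_iff : ∀ x, x ∈ a ↔ ∃ z, δ₁ z = x
  exact_one : ∀ z, δ₁ z = 0 → ∃ y, δ₂ y = z
  exact_two : ∀ y, δ₂ y = 0 → ∃ x, δ₃ x = y
  injective : Function.Injective δ₃

namespace ExactSeq

variable {R : Type} [CommRing R] {M : Type} [AddCommGroup M] [Module R M] {a b : Ideal R}

/-- The terms of the resolution. -/
def obj (R : Type) [CommRing R] (M : Type) [AddCommGroup M] [Module R M] :
    ℕ → ModuleCat.{0} R
  | 0 => ModuleCat.of R R
  | 1 => ModuleCat.of R M
  | 2 => ModuleCat.of R M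
  | 3 => ModuleCat.of R R
  | _ + 4 => ModuleCat.of R PUnit

instance [Module.Free R M] (n : ℕ) : Projective (obj R M n) := by
  have aux (Q : Type) [AddCommGroup Q] [Module R Q] [Module.Free R Q] :
    Projective (ModuleCat.of R Q) := (IsProjective.iff_projective Q).mp inferInstance
  match n with
  | 0 | 1 | 2 | 3 | _ + 4 => exact aux _

variable (D : ExactSeq R M a) (E : ExactSeq R M b)

/-- The differentials of the resolution. -/
def diff : ∀ n : ℕ, obj R M (n + 1) ⟶ obj R M n
  | 0 => ModuleCat.ofHom D.δ₁
  | 1 => ModuleCat.ofHom D.δ₂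
  | 2 => ModuleCat.ofHom D.δ₃
  | _ + 3 => 0

/-- The complex underlying the resolution. -/
noncomputable def complex : ChainComplex (ModuleCat.{0} R) ℕ :=
  ChainComplex.of (obj R M) D.diff fun n => by
    match n with
    | 0 => exact ModuleCat.hom_ext (LinearMap.ext D.δ₁_δ₂)
    | 1 => exact ModuleCat.hom_ext (LinearMap.ext D.δ₂_δ₃)
    | _ + 2 => exact zero_comp

lemma complex_d (n : ℕ) : D.complex.d (n + 1) n = D.diff n :=
  ChainComplex.of_d _ _ _

lemma complex_exactAt (n : ℕ) : D.complex.ExactAt (n + 1) := by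
  rw [HomologicalComplex.exactAt_iff' _ (n + 2) (n + 1) n (by simp) (by simp),
    ShortComplex.moduleCat_exact_iff]
  change ∀ x, D.complex.d (n + 1) n x = 0 → ∃ y, D.complex.d (n + 1 + 1) (n + 1) y = x
  rw [complex_d, complex_d]
  match n with
  | 0 => exact D.exact_one
  | 1 => exact D.exact_two
  | 2 => exact fun x hx => ⟨0, (D.injective (hx.trans (map_zero D.δ₃).symm)).symm⟩
  | _ + 3 => exact fun x _ => ⟨0, rfl⟩

/-- The augmentation of the resolution. -/
noncomputable def π :
    D.complex ⟶ (ChainComplex.single₀ (ModuleCat.{0} R)).obj (ModuleCat.of R (R ⧸ a)) :=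
  (ChainComplex.toSingle₀Equiv _ _).symm
    ⟨(ModuleCat.ofHom a.mkQ : ModuleCat.of R R ⟶ ModuleCat.of R (R ⧸ a)), by
      rw [complex_d]
      refine ModuleCat.hom_ext (LinearMap.ext fun z => ?_)
      exact (Submodule.Quotient.mk_eq_zero a).mpr ((D.mem_iff _).mpr ⟨z, rfl⟩)⟩

lemma π_f_zero :
    D.π.f 0 = (ModuleCat.ofHom a.mkQ : ModuleCat.of R R ⟶ ModuleCat.of R (R ⧸ a)) :=
  ChainComplex.toSingle₀Equiv_symm_apply_f_zero _ _

/-- The projective resolution of `R ⧸ a`. -/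
noncomputable def res [Module.Free R M] : ProjectiveResolution (ModuleCat.of R (R ⧸ a)) where
  complex := D.complex
  projective n := inferInstanceAs (Projective (obj R M n))
  π := D.π
  quasiIso := ⟨fun n => by
    cases n with
    | zero =>
      rw [ChainComplex.quasiIsoAt₀_iff, ShortComplex.quasiIso_iff_of_zeros' _ rfl rfl rfl]
      constructor
      · rw [ShortComplex.moduleCat_exact_iff]
        change ∀ x, D.π.f 0 x = 0 → ∃ y, D.complex.d 1 0 y = x
        rw [complex_d, π_f_zero]
        exact fun x hx => (D.mem_iff x).mp ((Submodule.Quotient.mk_eq_zero a).mp hx)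
      · change Epi (D.π.f 0)
        rw [π_f_zero]
        exact (ModuleCat.epi_iff_surjective _).mpr (Submodule.mkQ_surjective a)
    | succ n =>
      rw [quasiIsoAt_iff_exactAt' _ _ (ChainComplex.exactAt_succ_single_obj _ n)]
      exact D.complex_exactAt n⟩

section Map

variable {D E} {s φ : M →ₗ[R] M} {c : R}

/-- The components of a map of resolutions. -/
def mapF (s φ : M →ₗ[R] M) (c : R) : ∀ n : ℕ, obj R M n ⟶ obj R M n
  | 0 => 𝟙 _
  | 1 => ModuleCat.ofHom s
  | 2 => ModuleCat.ofHom φ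
  | 3 => ModuleCat.ofHom (LinearMap.mulLeft R c)
  | _ + 4 => 0

/-- A map of resolutions which is the identity of `R` in degree zero. -/
noncomputable def map (hs : ∀ z, E.δ₁ (s z) = D.δ₁ z) (hφ : ∀ y, E.δ₂ (φ y) = s (D.δ₂ y))
    (hc : ∀ x, φ (D.δ₃ x) = E.δ₃ (c * x)) : D.complex ⟶ E.complex :=
  ChainComplex.ofHom (X := D.complex) (Y := E.complex) (mapF s φ c) fun n => by
    rw [complex_d, complex_d]
    match n with
    | 0 => exact ModuleCat.hom_ext (LinearMap.ext hs)
    | 1 => exact ModuleCat.hom_ext (LinearMap.ext hφ)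
    | 2 => exact ModuleCat.hom_ext (LinearMap.ext fun x => (hc x).symm)
    | _ + 3 => exact zero_comp.trans zero_comp.symm

end Map

variable [Module.Free R M]

lemma res_d_four_three : D.res.complex.d 4 3 = 0 :=
  D.complex_d 3

/-- Multiplication by an element of `R`, in the top degree of the resolution. -/
noncomputable def topHom : R →ₗ[R] (D.res.complex.X 3 ⟶ ModuleCat.of R R) where
  toFun x :=
    (ModuleCat.ofHom (LinearMap.toSpanSingleton R R x) : ModuleCat.of R R ⟶ ModuleCat.of R R)
  map_add' x y := ModuleCat.hom_ext (LinearMap.ext fun z : R => mul_add z x y)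
  map_smul' r x := ModuleCat.hom_ext (LinearMap.ext fun z : R => mul_left_comm z r x)

/-- The map `R → Ext³(R ⧸ a, R)` given by the top degree of the resolution. -/
noncomputable def θ :
    R →ₗ[R] ((Ext R (ModuleCat.{0} R) 3).obj (op (ModuleCat.of R (R ⧸ a)))).obj
      (ModuleCat.of R R) :=
  topProj D.res (ModuleCat.of R R) D.res_d_four_three ∘ₗ D.topHom

lemma θ_surjective : Function.Surjective D.θ := by
  intro y
  obtain ⟨f, rfl⟩ := topProj_surjective D.res (ModuleCat.of R R) D.res_d_four_three y
  let f' : ModuleCat.of R R ⟶ ModuleCat.of R R := f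
  refine ⟨f' 1, congrArg (topProj D.res (ModuleCat.of R R) D.res_d_four_three) ?_⟩
  refine ModuleCat.hom_ext (LinearMap.ext_ring ?_)
  exact one_mul (f' 1)

lemma θ_eq_zero_iff (x : R) : D.θ x = 0 ↔ ∃ l : M →ₗ[R] R, l (D.δ₃ 1) = x := by
  refine (topProj_eq_zero_iff D.res (ModuleCat.of R R) D.res_d_four_three _).trans ?_
  change (∃ y : ModuleCat.of R M ⟶ ModuleCat.of R R, D.complex.d 3 2 ≫ y = _) ↔ _
  rw [complex_d]
  constructor
  · rintro ⟨y, hy⟩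
    refine ⟨y.hom, ?_⟩
    exact (congrArg (fun q : ModuleCat.of R R ⟶ ModuleCat.of R R => q.hom 1) hy).trans (one_mul x)
  · rintro ⟨l, rfl⟩
    refine ⟨ModuleCat.ofHom l, ModuleCat.hom_ext (LinearMap.ext_ring ?_)⟩
    exact (one_mul _).symm

lemma Ext_map_θ {s φ : M →ₗ[R] M} {c : R} (hs : ∀ z, E.δ₁ (s z) = D.δ₁ z)
    (hφ : ∀ y, E.δ₂ (φ y) = s (D.δ₂ y)) (hc : ∀ x, φ (D.δ₃ x) = E.δ₃ (c * x))
    (f : ModuleCat.of R (R ⧸ a) ⟶ ModuleCat.of R (R ⧸ b))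
    (hf : ∀ x : R, f.hom (Ideal.Quotient.mk a x) = Ideal.Quotient.mk b x) (x : R) :
    (((Ext R (ModuleCat.{0} R) 3).map f.op).app (ModuleCat.of R R)).hom (E.θ x) =
      D.θ (c * x) := by
  refine (topProj_naturality D.res E.res (ModuleCat.of R R) D.res_d_four_three E.res_d_four_three f
    (map hs hφ hc) ?_ _).trans ?_
  · change 𝟙 (ModuleCat.of R R) ≫ E.π.f 0 = D.π.f 0 ≫ f
    rw [π_f_zero, π_f_zero]
    exact ModuleCat.hom_ext (LinearMap.ext fun x => (hf x).symm)
  · refine congrArg (topProj D.res (ModuleCat.of R R) D.res_d_four_three) ?_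
    refine ModuleCat.hom_ext (LinearMap.ext_ring ?_)
    change c * 1 * x = 1 * (c * x)
    rw [mul_one, one_mul]

end ExactSeq

end Resolution

section Colimit

open CategoryTheory Limits Opposite

variable {R : Type} [CommRing R]

/-- A sequential colimit of cyclic modules, as a direct limit. -/
lemma exists_directLimit_equiv (K : ℕ ⥤ ModuleCat.{0} R) (I : ℕ → Ideal R) (c : ℕ → R)
    (θ : ∀ e, R →ₗ[R] K.obj e) (surj : ∀ e, Function.Surjective (θ e))
    (ker : ∀ e x, θ e x = 0 ↔ x ∈ I e)
    (comp : ∀ e x, (K.map (homOfLE (Nat.le_succ e))).hom (θ e x) = θ (e + 1) (c e * x)) :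
    ∃ f : ∀ i j : ℕ, i ≤ j → (R ⧸ I i) →ₗ[R] (R ⧸ I j),
      DirectedSystem (fun e => R ⧸ I e) (fun i j h => f i j h) ∧
      (∀ (e : ℕ) (x : R), f e (e + 1) (Nat.le_succ e) (Ideal.Quotient.mk (I e) x) =
        Ideal.Quotient.mk (I (e + 1)) (c e * x)) ∧
      Nonempty ((colimit K : ModuleCat.{0} R) ≃ₗ[R]
        Module.DirectLimit (fun e => R ⧸ I e) (fun i j h => f i j h)) := by
  have hker (e : ℕ) : I e = LinearMap.ker (θ e) :=
    Submodule.ext fun x => (ker e x).symm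
  let ε (e : ℕ) : (R ⧸ I e) ≃ₗ[R] K.obj e :=
    (Submodule.quotEquivOfEq _ _ (hker e)).trans ((θ e).quotKerEquivOfSurjective (surj e))
  have hε (e : ℕ) (x : R) : ε e (Ideal.Quotient.mk (I e) x) = θ e x := rfl
  let f (i j : ℕ) (h : i ≤ j) : (R ⧸ I i) →ₗ[R] (R ⧸ I j) :=
    (ε j).symm.toLinearMap ∘ₗ (K.map (homOfLE h)).hom ∘ₗ (ε i).toLinearMap
  have hf (i j : ℕ) (h : i ≤ j) (x : R ⧸ I i) : ε j (f i j h x) = (K.map (homOfLE h)).hom (ε i x) :=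
    (ε j).apply_symm_apply _
  have hsys : DirectedSystem (fun e => R ⧸ I e) (fun i j h => f i j h) :=
    { map_self := fun i x => (ε i).injective (by
        rw [hf]
        exact congrArg (fun q => q.hom (ε i x)) (K.map_id i))
      map_map := fun l j i hij hjl x => (ε l).injective (by
        rw [hf, hf, hf]
        exact (congrArg (fun q => q.hom (ε i x))
          (K.map_comp (homOfLE hij) (homOfLE hjl))).symm) }
  refine ⟨f, hsys, fun e x => (ε (e + 1)).injective ?_, ⟨?_⟩⟩
  · rw [hf, hε, hε]
    exact comp e x
  · let α : K ≅ ModuleCat.directLimitDiagram (fun e => R ⧸ I e) f :=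
      NatIso.ofComponents (fun e => (ε e).symm.toModuleIso) fun {i j} h => by
        refine ModuleCat.hom_ext (LinearMap.ext fun x => (ε j).injective ?_)
        exact ((ε j).apply_symm_apply _).trans ((hf i j h.le _).trans
          (congrArg (K.map h).hom ((ε i).apply_symm_apply x))).symm
    exact (HasColimit.isoOfNatIso α ≪≫ (colimit.isColimit _).coconePointUniqueUpToIso
      (ModuleCat.directLimitIsColimit (fun e => R ⧸ I e) f)).toLinearEquiv

/-- A descending sequence of ideals, as a functor. -/
def seqFunctor {I : ℕ → Ideal R} (hI : Antitone I) : ℕᵒᵖ ⥤ Ideal R where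
  obj t := I (unop t)
  map w := ⟨⟨hI w.unop.down.down⟩⟩

/-- A descending sequence of ideals with radical containing `J`, as a functor. -/
def seqToSelfLERadical {J : Ideal R} {I : ℕ → Ideal R} (hI : Antitone I)
    (hrad : ∀ e, J ≤ (I e).radical) : ℕᵒᵖ ⥤ localCohomology.SelfLERadical J :=
  ObjectProperty.lift _ (seqFunctor hI) fun t => hrad (unop t)

lemma seqToSelfLERadical_initial [IsNoetherianRing R] {J : Ideal R} {I : ℕ → Ideal R}
    (hI : Antitone I) (hrad : ∀ e, J ≤ (I e).radical) (hcof : ∀ n, ∃ e, I e ≤ J ^ n) :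
    (seqToSelfLERadical hI hrad).Initial where
  out J' := by
    obtain ⟨n, hn⟩ := Ideal.exists_pow_le_of_le_radical_of_fg J'.2 (IsNoetherian.noetherian J)
    obtain ⟨e, he⟩ := hcof n
    have : Nonempty (CostructuredArrow (seqToSelfLERadical hI hrad) J') :=
      ⟨CostructuredArrow.mk
        (⟨⟨⟨he.trans hn⟩⟩⟩ : (seqToSelfLERadical hI hrad).obj (op e) ⟶ J')⟩
    refine zigzag_isConnected fun j₁ j₂ => Relation.ReflTransGen.single ?_
    rcases le_total (unop j₁.left) (unop j₂.left) with h | h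
    · exact Or.inr ⟨CostructuredArrow.homMk (homOfLE h).op rfl⟩
    · exact Or.inl ⟨CostructuredArrow.homMk (homOfLE h).op rfl⟩

/-- The sequence of modules `Extⁱ(R ⧸ I e, Y)`. -/
noncomputable def extSeq {I : ℕ → Ideal R} (hI : Antitone I) (i : ℕ) (Y : ModuleCat.{0} R) :
    ℕ ⥤ ModuleCat.{0} R :=
  opOp ℕ ⋙ localCohomology.diagram (seqFunctor hI) i ⋙ (evaluation _ _).obj Y

/-- Local cohomology as a sequential colimit. -/
lemma localCohomology_iso_colimit [IsNoetherianRing R] {J : Ideal R} {I : ℕ → Ideal R}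
    (hI : Antitone I) (hrad : ∀ e, J ≤ (I e).radical) (hcof : ∀ n, ∃ e, I e ≤ J ^ n) (i : ℕ)
    (Y : ModuleCat.{0} R) : Nonempty ((localCohomology J i).obj Y ≅ colimit (extSeq hI i Y)) := by
  have := seqToSelfLERadical_initial hI hrad hcof
  let α : localCohomology J i ≅ localCohomology.ofDiagram (seqFunctor hI) i :=
    (localCohomology.isoSelfLERadical J i).symm ≪≫
      (localCohomology.isoOfFinal (seqToSelfLERadical hI hrad)
        (localCohomology.selfLERadicalDiagram J) i).symm
  exact ⟨α.app Y ≪≫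
    colimitObjIsoColimitCompEvaluation (localCohomology.diagram (seqFunctor hI) i) Y ≪≫
    (Functor.Final.colimitIso (opOp ℕ) _).symm⟩

theorem exists_localCohomology_equiv [IsNoetherianRing R] {M : Type} [AddCommGroup M] [Module R M]
    [Module.Free R M] {J : Ideal R} {I : ℕ → Ideal R}
    (hI : Antitone I) (hrad : ∀ e, J ≤ (I e).radical) (hcof : ∀ n, ∃ e, I e ≤ J ^ n)
    (D : ∀ e, ExactSeq R M (I e)) (hD : ∀ e x, x ∈ I e ↔ ∃ l : M →ₗ[R] R, l ((D e).δ₃ 1) = x)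
    (c : ℕ → R) (hc : ∀ e, ∃ s φ : M →ₗ[R] M, (∀ z, (D e).δ₁ (s z) = (D (e + 1)).δ₁ z) ∧
      (∀ y, (D e).δ₂ (φ y) = s ((D (e + 1)).δ₂ y)) ∧
      ∀ x, φ ((D (e + 1)).δ₃ x) = (D e).δ₃ (c e * x)) :
    ∃ f : ∀ i j : ℕ, i ≤ j → (R ⧸ I i) →ₗ[R] (R ⧸ I j),
      DirectedSystem (fun e => R ⧸ I e) (fun i j h => f i j h) ∧
      (∀ (e : ℕ) (x : R), f e (e + 1) (Nat.le_succ e) (Ideal.Quotient.mk (I e) x) =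
        Ideal.Quotient.mk (I (e + 1)) (c e * x)) ∧
      Nonempty ((localCohomology J 3).obj (ModuleCat.of R R) ≃ₗ[R]
        Module.DirectLimit (fun e => R ⧸ I e) (fun i j h => f i j h)) := by
  obtain ⟨α⟩ := localCohomology_iso_colimit hI hrad hcof 3 (ModuleCat.of R R)
  obtain ⟨f, hf, hfc, ⟨β⟩⟩ := exists_directLimit_equiv (extSeq hI 3 (ModuleCat.of R R)) I c
    (fun e => (D e).θ) (fun e => (D e).θ_surjective)
    (fun e x => ((D e).θ_eq_zero_iff x).trans (hD e x).symm) fun e x => by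
      obtain ⟨s, φ, hs, hφ, h⟩ := hc e
      exact ExactSeq.Ext_map_θ (D (e + 1)) (D e) hs hφ h _ (fun x => rfl) x
  exact ⟨f, hf, hfc, ⟨α.toLinearEquiv.trans β⟩⟩

end Colimit

section FrobPow

variable {R : Type} [CommRing R]

lemma frobPow_eq_map (p : ℕ) [ExpChar R p] (e : ℕ) (a : Ideal R) :
    frobPow (p ^ e) a = a.map (iterateFrobenius R p e) := rfl

lemma frobPow_le_of_dvd {q r : ℕ} (h : q ∣ r) (hr : r ≠ 0) (a : Ideal R) :
    frobPow r a ≤ frobPow q a := by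
  obtain ⟨s, rfl⟩ := h
  rw [frobPow, Ideal.span_le]
  rintro _ ⟨x, hx, rfl⟩
  change x ^ (q * s) ∈ _
  rw [pow_mul]
  exact Ideal.pow_mem_of_mem _ (Ideal.subset_span (Set.mem_image_of_mem _ hx)) _
    (Nat.pos_of_ne_zero (right_ne_zero_of_mul hr))

lemma le_radical_frobPow (q : ℕ) (a : Ideal R) : a ≤ (frobPow q a).radical :=
  fun _ hx => ⟨q, Ideal.subset_span (Set.mem_image_of_mem _ hx)⟩

lemma frobPow_le_pow {n q : ℕ} (h : n ≤ q) (a : Ideal R) : frobPow q a ≤ a ^ n := by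
  rw [frobPow, Ideal.span_le]
  rintro _ ⟨_, hx, rfl⟩
  exact Ideal.pow_le_pow_right h (Ideal.pow_mem_pow hx q)

end FrobPow

section Generators

variable {R : Type} [CommRing R] {N : ℕ} (X : Matrix (Fin (N + 2)) (Fin (N + 1)) R)

/-- The ideal generated by the entries of the first differential. -/
def genIdeal : Ideal R := Ideal.span (Set.range (γ X) ∪ Set.range (g X))

variable {X}

lemma γ_mem_genIdeal (i : Fin N) : γ X i ∈ genIdeal X :=
  Ideal.subset_span (Or.inl ⟨i, rfl⟩)

lemma g_mem_genIdeal (j : Fin (N + 1)) : g X j ∈ genIdeal X :=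
  Ideal.subset_span (Or.inr ⟨j, rfl⟩)

lemma g_dotProduct_mem_genIdeal (v : Fin (N + 1) → R) : g X ⬝ᵥ v ∈ genIdeal X :=
  sum_mem fun j _ => Ideal.mul_mem_right _ _ (g_mem_genIdeal j)

lemma mem_genIdeal_iff_d₁ {x : R} : x ∈ genIdeal X ↔ ∃ z, d₁ X z = x := by
  constructor
  · refine fun hx => (?_ : genIdeal X ≤ LinearMap.range (d₁ X)) hx
    rw [genIdeal, Ideal.span_le]
    rintro _ (⟨i, rfl⟩ | ⟨j, rfl⟩)
    · exact ⟨(Pi.single i 1, 0), by simp [d₁_apply]⟩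
    · exact ⟨(0, Pi.single j 1), by simp [d₁_apply]⟩
  · rintro ⟨z, rfl⟩
    rw [d₁_apply]
    exact add_mem (sum_mem fun i _ => Ideal.mul_mem_right _ _ (γ_mem_genIdeal i))
      (g_dotProduct_mem_genIdeal _)

lemma mem_genIdeal_iff_d₃ {x : R} :
    x ∈ genIdeal X ↔ ∃ l : Mid R N →ₗ[R] R, l (d₃ X 1) = x := by
  constructor
  · refine fun hx => (?_ : genIdeal X ≤ LinearMap.range (LinearMap.applyₗ (d₃ X 1))) hx
    rw [genIdeal, Ideal.span_le]
    rintro _ (⟨i, rfl⟩ | ⟨j, rfl⟩)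
    · exact ⟨-(LinearMap.proj i ∘ₗ LinearMap.fst R _ _), by simp [d₃_apply]⟩
    · exact ⟨LinearMap.proj j ∘ₗ LinearMap.snd R _ _, by simp [d₃_apply]⟩
  · rintro ⟨l, rfl⟩
    have h : l (d₃ X 1) = (l ∘ₗ LinearMap.inl R _ _) (-γ X) + (l ∘ₗ LinearMap.inr R _ _) (g X) := by
      rw [LinearMap.comp_apply, LinearMap.comp_apply, ← map_add]
      simp [d₃_apply]
    rw [h, LinearMap.pi_apply_eq_sum_univ, LinearMap.pi_apply_eq_sum_univ (l ∘ₗ _)]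
    exact add_mem
      (sum_mem fun i _ => Ideal.mul_mem_right _ _ (neg_mem (γ_mem_genIdeal i)))
      (sum_mem fun j _ => Ideal.mul_mem_right _ _ (g_mem_genIdeal j))

end Generators

section Final

variable (k : Type) [Field k] (N : ℕ)

lemma neg_one_pow_mul_mem_iff {R : Type} [CommRing R] {I : Ideal R} {n : ℕ} {x : R} :
    (-1) ^ n * x ∈ I ↔ x ∈ I := by
  rcases neg_one_pow_eq_or R n with h | h <;> simp [h]

lemma Omeg_eq_genIdeal : Omeg k N = genIdeal (gen k N) := by
  apply le_antisymm
  · refine sup_le (Ideal.span_le.mpr ?_) (Ideal.span_le.mpr ?_)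
    · rintro _ ⟨i, rfl⟩
      change bigMinor (gen k N) i ∈ genIdeal (gen k N)
      induction i using Fin.lastCases with
      | last =>
        rw [bigMinor_last, neg_one_pow_mul_mem_iff]
        exact g_dotProduct_mem_genIdeal _
      | cast i =>
        induction i using Fin.lastCases with
        | last =>
          rw [bigMinor_penult, neg_one_pow_mul_mem_iff]
          exact g_dotProduct_mem_genIdeal _
        | cast i => exact neg_one_pow_mul_mem_iff.mp (γ_mem_genIdeal i)
    · rintro _ ⟨j, rfl⟩
      exact neg_one_pow_mul_mem_iff.mp (g_mem_genIdeal (X := gen k N) j)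
  · rw [genIdeal, Ideal.span_le]
    rintro _ (⟨i, rfl⟩ | ⟨j, rfl⟩)
    · exact neg_one_pow_mul_mem_iff.mpr (le_sup_left (a := Imax k N)
        (Ideal.subset_span ⟨Fin.castAdd 2 i, rfl⟩))
    · exact neg_one_pow_mul_mem_iff.mpr (le_sup_right (a := Imax k N)
        (Ideal.subset_span ⟨j, rfl⟩))

/-- The ring of power series in the entries of the generic matrix. -/
abbrev Gen (k : Type) [Field k] (N : ℕ) : Type := MvPowerSeries (Fin (N + 2) × Fin (N + 1)) k

lemma ugen_eq (p : ℕ) : ugen k N p = lastProd k N ^ (p - 1) := by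
  have h : ((-1) ^ N * (-1) ^ N : MvPowerSeries (Fin (N + 2) × Fin (N + 1)) k) = 1 := by
    rw [← mul_pow, neg_one_mul, neg_neg, one_pow]
  change (bigMinor (gen k N) (Fin.last _) * bigMinor (gen k N) (Fin.last N).castSucc) ^ _ = _
  rw [bigMinor_last, bigMinor_penult, mul_mul_mul_comm, h, one_mul, lastProd]

variable (p : ℕ) [Fact p.Prime]

lemma antitone_frobPow_Omeg : Antitone fun e => frobPow (p ^ e) (Omeg k N) :=
  antitone_nat_of_succ_le fun _ =>
    frobPow_le_of_dvd (pow_dvd_pow p (Nat.le_succ _)) (ppow_ne_zero p _) _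

variable [CharP k p]

lemma frobPow_Omeg (e : ℕ) : frobPow (p ^ e) (Omeg k N) = genIdeal (genPow k N p e) := by
  rw [Omeg_eq_genIdeal, frobPow_eq_map, genIdeal, Ideal.map_span, Set.image_union,
    ← Set.range_comp, ← Set.range_comp]
  have hγ : iterateFrobenius _ p e ∘ γ (gen k N) = γ (genPow k N p e) :=
    funext fun i => (γ_genPow k p e i).symm
  have hg : iterateFrobenius _ p e ∘ g (gen k N) = g (genPow k N p e) :=
    funext fun i => (g_genPow k p e i).symm
  rw [hγ, hg, genIdeal]

variable (e : ℕ) [NeZero N]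

/-- The resolution of `R ⧸ Ω^{[p^e]}`. -/
noncomputable def exactSeq : ExactSeq (Gen k N)
    (Mid (Gen k N) N) (frobPow (p ^ e) (Omeg k N)) where
  δ₁ := d₁ (genPow k N p e)
  δ₂ := d₂ (genPow k N p e)
  δ₃ := d₃ (genPow k N p e)
  δ₁_δ₂ := d₁_d₂ _
  δ₂_δ₃ := d₂_d₃ _
  mem_iff x := by rw [frobPow_Omeg, mem_genIdeal_iff_d₁]
  exact_one _ := exact_one_genPow k p e
  exact_two _ := exact_two_genPow k p e
  injective := (injective_iff_map_eq_zero _).mpr fun _ =>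
    d₃_injective _ (g_last_genPow_ne_zero k p e)

lemma mem_frobPow_Omeg_iff (x : Gen k N) :
    x ∈ frobPow (p ^ e) (Omeg k N) ↔
      ∃ l : Mid (Gen k N) N →ₗ[Gen k N] Gen k N,
        l ((exactSeq k N p e).δ₃ 1) = x :=
  (SetLike.ext_iff.mp (frobPow_Omeg k N p e) x).trans mem_genIdeal_iff_d₃

lemma exists_map_exactSeq : ∃ s φ : Mid (Gen k N) N →ₗ[Gen k N]
      Mid (Gen k N) N,
    (∀ z, (exactSeq k N p e).δ₁ (s z) = (exactSeq k N p (e + 1)).δ₁ z) ∧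
    (∀ y, (exactSeq k N p e).δ₂ (φ y) = s ((exactSeq k N p (e + 1)).δ₂ y)) ∧
    ∀ x, φ ((exactSeq k N p (e + 1)).δ₃ x) =
      (exactSeq k N p e).δ₃ (ugen k N p ^ p ^ e * x) := by
  obtain ⟨φ, hφ, h⟩ := exists_chainMap_genPow k (N := N) p e
  have hp : p - 1 + 1 = p := Nat.sub_add_cancel (Fact.out : p.Prime).one_le
  refine ⟨scale (genPow k N p e) (p - 1), φ, d₁_scale _ (fun i => ?_) (fun i => ?_), hφ, ?_⟩
  · rw [γ_genPow, γ_genPow, hp, ← pow_mul, ← pow_succ]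
  · rw [g_genPow, g_genPow, hp, ← pow_mul, ← pow_succ]
  · rw [ugen_eq]
    exact h

lemma ugen_pow_mul_mem {x : Gen k N}
    (hx : x ∈ frobPow (p ^ e) (Omeg k N)) :
    ugen k N p ^ p ^ e * x ∈ frobPow (p ^ (e + 1)) (Omeg k N) := by
  obtain ⟨l, rfl⟩ := (mem_frobPow_Omeg_iff k N p e x).mp hx
  obtain ⟨s, φ, -, -, hφ⟩ := exists_map_exactSeq k N p e
  refine (mem_frobPow_Omeg_iff k N p (e + 1) _).mpr ⟨l ∘ₗ φ, ?_⟩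
  rw [LinearMap.comp_apply, hφ, ← smul_eq_mul, ← smul_eq_mul, map_smul, map_smul]

lemma exists_localCohomology_Omeg_equiv :
    ∃ f : ∀ i j : ℕ, i ≤ j →
        quotFrobOm k N p i →ₗ[MvPowerSeries (Fin (N + 2) × Fin (N + 1)) k] quotFrobOm k N p j,
      DirectedSystem (quotFrobOm k N p) (fun i j h => f i j h) ∧
      (∀ (e : ℕ) (x : MvPowerSeries (Fin (N + 2) × Fin (N + 1)) k),
        f e (e + 1) (Nat.le_succ e) (Ideal.Quotient.mk (frobPow (p ^ e) (Omeg k N)) x) =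
          Ideal.Quotient.mk (frobPow (p ^ (e + 1)) (Omeg k N)) (ugen k N p ^ p ^ e * x)) ∧
      Nonempty
        (((localCohomology (Omeg k N) 3).obj
            (ModuleCat.of _ (MvPowerSeries (Fin (N + 2) × Fin (N + 1)) k)))
          ≃ₗ[MvPowerSeries (Fin (N + 2) × Fin (N + 1)) k]
          Module.DirectLimit (quotFrobOm k N p) (fun i j h => f i j h)) :=
  exists_localCohomology_equiv (antitone_frobPow_Omeg k N p) (fun _ => le_radical_frobPow _ _)
    (fun n => ⟨n, frobPow_le_pow (Nat.lt_pow_self (Fact.out : p.Prime).one_lt).le _⟩)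
    (fun e => exactSeq k N p e) (fun e => mem_frobPow_Omeg_iff k N p e)
    (fun e => ugen k N p ^ p ^ e)
    fun e => exists_map_exactSeq k N p e

end Final

end PfaffianLink

/-- For `n ≥ 3` (here `n = m + 3`, i.e. the parameter is `m + 1`) and
`u = (G_n G_{n-1})^{p-1}`, multiplication by `u^{p^e}` maps `Ω^{[p^e]}` into `Ω^{[p^{e+1}]}`,
and `H³_{I_{n-1}(X) + I_{n-2}(X')}(k[[X]]) = H³_Ω(R)` is the colimit of the direct system
`R/Ω → R/Ω^{[p]} → R/Ω^{[p²]} → ⋯` whose `e`-th transition map is induced by multiplication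
by `u^{p^e}`. -/
theorem stmt14 (p : ℕ) (hp : p.Prime) (k : Type) [Field k] [CharP k p] (m : ℕ) :
    (∀ e : ℕ, ∀ x ∈ frobPow (p ^ e) (Omeg k (m + 1)),
      ugen k (m + 1) p ^ p ^ e * x ∈ frobPow (p ^ (e + 1)) (Omeg k (m + 1))) ∧
    ∃ f : ∀ i j : ℕ, i ≤ j →
        quotFrobOm k (m + 1) p i →ₗ[MvPowerSeries (Fin (m + 3) × Fin (m + 2)) k]
          quotFrobOm k (m + 1) p j,
      DirectedSystem (quotFrobOm k (m + 1) p) (fun i j h => f i j h) ∧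
      (∀ (e : ℕ) (x : MvPowerSeries (Fin (m + 3) × Fin (m + 2)) k),
        f e (e + 1) (Nat.le_succ e) (Ideal.Quotient.mk (frobPow (p ^ e) (Omeg k (m + 1))) x) =
          Ideal.Quotient.mk (frobPow (p ^ (e + 1)) (Omeg k (m + 1)))
            (ugen k (m + 1) p ^ p ^ e * x)) ∧
      Nonempty
        (((localCohomology (Omeg k (m + 1)) 3).obj
            (ModuleCat.of _ (MvPowerSeries (Fin (m + 3) × Fin (m + 2)) k)))
          ≃ₗ[MvPowerSeries (Fin (m + 3) × Fin (m + 2)) k]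
          Module.DirectLimit (quotFrobOm k (m + 1) p) (fun i j h => f i j h)) := by
  have : Fact p.Prime := ⟨hp⟩
  exact ⟨fun e _ => PfaffianLink.ugen_pow_mul_mem k (m + 1) p e,
    PfaffianLink.exists_localCohomology_Omeg_equiv k (m + 1) p⟩
end

section
/- Let k be a perfect field of characteristic p = 2 or p = 3, R = k[[x, y, z, w, s, t]], and let φ be the generic symmetric 3 × 3 matrix with rows (x, w, t), (w, y, s), (t, s, z). Then the ring A = R/I_2(φ), where I_2(φ) is the ideal generated by the 2 × 2 minors of φ, is strongly F-regular. -/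
/- `R = k[[x, y, z, w, s, t]]`, with the six variables indexed by `Fin 6` in the order
`x, y, z, w, s, t`. -/
noncomputable def px (k : Type) [Field k] : MvPowerSeries (Fin 6) k := MvPowerSeries.X 0
noncomputable def py (k : Type) [Field k] : MvPowerSeries (Fin 6) k := MvPowerSeries.X 1
noncomputable def pz (k : Type) [Field k] : MvPowerSeries (Fin 6) k := MvPowerSeries.X 2
noncomputable def pw (k : Type) [Field k] : MvPowerSeries (Fin 6) k := MvPowerSeries.X 3
noncomputable def ps (k : Type) [Field k] : MvPowerSeries (Fin 6) k := MvPowerSeries.X 4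
noncomputable def pt (k : Type) [Field k] : MvPowerSeries (Fin 6) k := MvPowerSeries.X 5

/-- The generic symmetric `3 × 3` matrix `φ` with rows `(x, w, t), (w, y, s), (t, s, z)`. -/
noncomputable def symMat (k : Type) [Field k] : Matrix (Fin 3) (Fin 3) (MvPowerSeries (Fin 6) k) :=
  !![px k, pw k, pt k; pw k, py k, ps k; pt k, ps k, pz k]

/-- `I₂(φ)`: the ideal generated by the `2 × 2` minors of `φ`. -/
noncomputable def I2sym (k : Type) [Field k] : Ideal (MvPowerSeries (Fin 6) k) :=
  Ideal.span {d | ∃ (i i' j j' : Fin 3), i < i' ∧ j < j' ∧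
    d = symMat k i j * symMat k i' j' - symMat k i j' * symMat k i' j}

/-- `A` is strongly `F`-regular. -/
def StronglyFRegular (p : ℕ) (A : Type) [CommRing A] : Prop :=
  ∀ c : A, (∀ P ∈ minimalPrimes A, c ∉ P) →
    ∃ (e : ℕ) (ψ : A →+ A), 1 ≤ e ∧ (∀ a x : A, ψ (a ^ p ^ e * x) = a * ψ x) ∧ ψ c = 1

namespace MvPowerSeries

section CartierMap

variable {σ k : Type*} [Field k] (p : ℕ) [ExpChar k p]

theorem coeff_pow_expChar_pow_smul (f : MvPowerSeries σ k) (e : ℕ) (m : σ →₀ ℕ) :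
    coeff (p ^ e • m) (f ^ p ^ e) = coeff m f ^ p ^ e := by
  rw [← map_iterateFrobenius_expand p (expChar_ne_zero k p) f e, coeff_map, coeff_expand_smul,
    iterateFrobenius_def]

theorem exists_eq_smul_of_coeff_pow_expChar_pow_ne_zero (f : MvPowerSeries σ k) (e : ℕ)
    {n : σ →₀ ℕ} (h : coeff n (f ^ p ^ e) ≠ 0) : ∃ m, n = p ^ e • m := by
  rw [← map_iterateFrobenius_expand p (expChar_ne_zero k p) f e, coeff_map] at h
  have hn : n ∈ Function.support
      (expand (p ^ e) (pow_ne_zero e (expChar_ne_zero k p)) f) := by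
    intro h0
    apply h
    rw [coeff_apply, h0, map_zero]
  obtain ⟨m, -, rfl⟩ := support_expand_subset _ _ _ hn
  exact ⟨m, rfl⟩

theorem coeff_pow_expChar_pow_mul (f g : MvPowerSeries σ k) (e : ℕ) {m : σ →₀ ℕ}
    (hm : ∀ i, m i < p ^ e) (n : σ →₀ ℕ) [DecidableEq σ] :
    coeff (p ^ e • n + m) (f ^ p ^ e * g) =
      ∑ u ∈ Finset.HasAntidiagonal.antidiagonal n,
        coeff u.1 f ^ p ^ e * coeff (p ^ e • u.2 + m) g := by
  have hq : p ^ e ≠ 0 := pow_ne_zero e (expChar_ne_zero k p)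
  rw [coeff_mul]
  symm
  refine Finset.sum_of_injOn (fun u => (p ^ e • u.1, p ^ e • u.2 + m)) ?_ ?_ ?_ ?_
  · rintro ⟨a, b⟩ - ⟨c, d⟩ - h
    simpa [nsmul_right_inj hq] using h
  · rintro ⟨a, b⟩ h
    simp only [Finset.mem_coe, Finset.HasAntidiagonal.mem_antidiagonal] at h ⊢
    rw [← h, smul_add, add_assoc]
  · rintro ⟨a, b⟩ hab hnot
    rw [Finset.HasAntidiagonal.mem_antidiagonal] at hab
    by_contra hne
    obtain ⟨u, rfl⟩ := exists_eq_smul_of_coeff_pow_expChar_pow_ne_zero p f e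
      (left_ne_zero_of_mul hne)
    have hle : u ≤ n := by
      intro i
      have h1 : p ^ e * u i + b i = p ^ e * n i + m i := by
        simpa using DFunLike.congr_fun hab i
      by_contra! hlt
      have := Nat.mul_le_mul_left (p ^ e) (Nat.succ_le_of_lt hlt)
      rw [Nat.mul_succ] at this
      have := hm i
      omega
    apply hnot
    refine ⟨(u, n - u), by simp [hle], ?_⟩
    simp only [Prod.mk.injEq, true_and]
    apply add_left_cancel (a := p ^ e • u)
    rw [hab, ← add_assoc, ← smul_add, add_tsub_cancel_of_le hle]
  · rintro ⟨a, b⟩ -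
    rw [coeff_pow_expChar_pow_smul]

variable [PerfectRing k p]

/-- The dual of `X ^ m` in the monomial basis of power series over `p ^ e`-th powers. -/
noncomputable def cartierMap (e : ℕ) (m : σ →₀ ℕ) : MvPowerSeries σ k →+ MvPowerSeries σ k where
  toFun f := fun n => (iterateFrobeniusEquiv k p e).symm (coeff (p ^ e • n + m) f)
  map_zero' := funext fun n => by rw [map_zero, map_zero]; rfl
  map_add' f g := funext fun n => by rw [map_add, map_add]; rfl

theorem coeff_cartierMap (e : ℕ) (m n : σ →₀ ℕ) (f : MvPowerSeries σ k) :
    coeff n (cartierMap p e m f) =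
      (iterateFrobeniusEquiv k p e).symm (coeff (p ^ e • n + m) f) := rfl

theorem cartierMap_pow_mul (e : ℕ) {m : σ →₀ ℕ} (hm : ∀ i, m i < p ^ e)
    (f g : MvPowerSeries σ k) :
    cartierMap p e m (f ^ p ^ e * g) = f * cartierMap p e m g := by
  classical
  ext n
  rw [coeff_cartierMap, coeff_pow_expChar_pow_mul p f g e hm, map_sum, coeff_mul]
  refine Finset.sum_congr rfl fun u _ => ?_
  rw [map_mul, coeff_cartierMap, ← iterateFrobeniusEquiv_def, RingEquiv.symm_apply_apply]

end CartierMap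

end MvPowerSeries

/-- A subring of a power series ring over a perfect field that splits off as a module is
strongly `F`-regular. -/
theorem stronglyFRegular_of_split_mvPowerSeries {σ k : Type*} [Field k] {p : ℕ} (hp : p.Prime)
    [ExpChar k p] [PerfectRing k p] {A : Type} [CommRing A] (f : A →+* MvPowerSeries σ k)
    (ρ : MvPowerSeries σ k →+ A) (hρ : ∀ a g, ρ (f a * g) = a * ρ g) (hρ1 : ρ 1 = 1) :
    StronglyFRegular p A := by
  have hinj : Function.Injective f := by
    refine Function.LeftInverse.injective (g := ρ) fun a => ?_
    rw [← mul_one (f a), hρ, hρ1, mul_one]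
  have : IsDomain (MvPowerSeries σ k) := NoZeroDivisors.to_isDomain _
  have : IsDomain A := hinj.isDomain f
  intro c hc
  have hc0 : c ≠ 0 := by
    rintro rfl
    exact hc ⊥ (by simp [IsDomain.minimalPrimes_eq_singleton_bot]) (zero_mem _)
  have hfc : f c ≠ 0 := (map_ne_zero_iff f hinj).mpr hc0
  obtain ⟨m, hm⟩ := (MvPowerSeries.ne_zero_iff_exists_coeff_ne_zero _).mp hfc
  set e := m.degree + 1
  have hme : ∀ i, m i < p ^ e := fun i =>
    ((Finsupp.le_degree i m).trans (Nat.le_succ _)).trans_lt (Nat.lt_pow_self hp.one_lt)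
  have hu : IsUnit (MvPowerSeries.cartierMap p e m (f c)) := by
    rw [MvPowerSeries.isUnit_iff_constantCoeff, ← MvPowerSeries.coeff_zero_eq_constantCoeff_apply,
      MvPowerSeries.coeff_cartierMap, isUnit_iff_ne_zero]
    simpa using hm
  obtain ⟨v, hv⟩ := hu.exists_left_inv
  refine ⟨e, (ρ.comp (AddMonoidHom.mulLeft v)).comp
    ((MvPowerSeries.cartierMap p e m).comp f.toAddMonoidHom), by omega, fun a x => ?_, ?_⟩
  · simp [MvPowerSeries.cartierMap_pow_mul p e hme, mul_left_comm v, hρ]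
  · simp [hv, hρ1]

namespace MvPowerSeries

section BinomialDivision

variable {σ R : Type*} [CommRing R] {α β : σ →₀ ℕ} {wt : (σ →₀ ℕ) → ℕ}

open Classical in
/-- The quotient in the division of `f` by the binomial `X ^ α - X ^ β`. -/
noncomputable def binomialQuotient (hwt : ∀ m, β ≤ m → wt (m - β + α) < wt m)
    (f : MvPowerSeries σ R) (m : σ →₀ ℕ) : R :=
  coeff (m + α) f + if _h : β ≤ m then binomialQuotient hwt f (m - β + α) else 0
termination_by wt m
decreasing_by exact hwt m _h

theorem exists_of_binomialQuotient_ne_zero (hwt : ∀ m, β ≤ m → wt (m - β + α) < wt m)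
    (f : MvPowerSeries σ R) (m : σ →₀ ℕ) (h : binomialQuotient hwt f m ≠ 0) :
    ∃ (j : ℕ) (n : σ →₀ ℕ), n + j • β = m + (j + 1) • α ∧ coeff n f ≠ 0 := by
  induction hN : wt m using Nat.strong_induction_on generalizing m with
  | _ N ih =>
  rw [binomialQuotient] at h
  by_cases h0 : coeff (m + α) f = 0
  · rw [h0, zero_add] at h
    split_ifs at h with hβ
    · obtain ⟨j, n, hn, hf⟩ := ih _ (hN ▸ hwt m hβ) _ h rfl
      refine ⟨j + 1, n, ?_, hf⟩
      calc n + (j + 1) • β = n + j • β + β := by rw [succ_nsmul, add_assoc]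
        _ = m - β + β + (j + 1 + 1) • α := by rw [hn, succ_nsmul α (j + 1)]; ac_rfl
        _ = m + (j + 1 + 1) • α := by rw [tsub_add_cancel_of_le hβ]
    · exact absurd rfl h
  · exact ⟨0, m + α, by simp, h0⟩

theorem exists_binomial_division (hwt : ∀ m, β ≤ m → wt (m - β + α) < wt m)
    (hdisj : ∀ m, α ≤ m → β ≤ m → β ≤ m - α) (f : MvPowerSeries σ R) :
    ∃ q : MvPowerSeries σ R, ∀ m, coeff m (f - (monomial α 1 - monomial β 1) * q) ≠ 0 →
      ¬ α ≤ m ∧ ∃ (j : ℕ) (n : σ →₀ ℕ), n + j • β = m + j • α ∧ coeff n f ≠ 0 := by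
  classical
  let q : MvPowerSeries σ R := fun m => binomialQuotient hwt f m
  have hq : ∀ m, coeff m q = binomialQuotient hwt f m := fun _ => rfl
  refine ⟨q, fun m hm => ?_⟩
  rw [map_sub, sub_mul, map_sub, coeff_monomial_mul, coeff_monomial_mul, one_mul, one_mul,
    hq, hq] at hm
  by_cases hα : α ≤ m
  · rw [if_pos hα, binomialQuotient, tsub_add_cancel_of_le hα] at hm
    by_cases hβ : β ≤ m
    · have h1 := hdisj m hα hβ
      have h2 : m - α - β + α = m - β := by
        rw [tsub_right_comm, tsub_add_cancel_of_le]
        rw [le_tsub_iff_right hβ, add_comm]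
        exact (le_tsub_iff_right hα).mp h1
      rw [dif_pos h1, if_pos hβ, h2] at hm
      simp at hm
    · rw [dif_neg fun h => hβ (h.trans tsub_le_self), if_neg hβ] at hm
      simp at hm
  · refine ⟨hα, ?_⟩
    by_cases h0 : coeff m f = 0
    · rw [if_neg hα, h0] at hm
      split_ifs at hm with hβ
      · simp only [zero_sub, neg_neg] at hm
        obtain ⟨j, n, hn, hf⟩ := exists_of_binomialQuotient_ne_zero hwt f _ (by simpa using hm)
        refine ⟨j + 1, n, ?_, hf⟩
        rw [succ_nsmul, ← add_assoc, hn, add_right_comm, tsub_add_cancel_of_le hβ]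
      · simp at hm
    · exact ⟨0, m, by simp, h0⟩

end BinomialDivision

end MvPowerSeries

open Finsupp (single)
open MvPowerSeries (X coeff monomial)

section VeroneseReduction

variable {k : Type} [Field k]

theorem minor_mem_I2sym {i i' j j' : Fin 3} (hi : i < i') (hj : j < j') :
    symMat k i j * symMat k i' j' - symMat k i j' * symMat k i' j ∈ I2sym k :=
  Ideal.subset_span ⟨i, i', j, j', hi, hj, rfl⟩

theorem exists_sub_mem_of_monomial_sub_mem {I : Ideal (MvPowerSeries (Fin 6) k)}
    {α β : Fin 6 →₀ ℕ}
    (hI : monomial α 1 - monomial β 1 ∈ I)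
    (hα : α 0 = 0 ∧ α 1 = 0 ∧ α 2 = 0) (hβ : 0 < β 0 + β 1 + β 2)
    (hdisj : ∀ v, α v = 0 ∨ β v = 0) {P Q : (Fin 6 →₀ ℕ) → Prop}
    (hPQ : ∀ m n t, P n → m 3 < α 3 ∨ m 4 < α 4 ∨ m 5 < α 5 →
      n 3 + t * β 3 = m 3 + t * α 3 → n 4 + t * β 4 = m 4 + t * α 4 →
      n 5 + t * β 5 = m 5 + t * α 5 → Q m)
    {r : MvPowerSeries (Fin 6) k}
    (hr : ∃ r', r - r' ∈ I ∧ ∀ m, coeff m r' ≠ 0 → P m) :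
    ∃ r', r - r' ∈ I ∧ ∀ m, coeff m r' ≠ 0 → Q m := by
  obtain ⟨r₁, hr₁, hP⟩ := hr
  have hwt (m : Fin 6 →₀ ℕ) (hm : β ≤ m) :
      (m - β + α) 0 + (m - β + α) 1 + (m - β + α) 2 < m 0 + m 1 + m 2 := by
    have := hm 0
    have := hm 1
    have := hm 2
    simp [hα]
    omega
  have hle (m : Fin 6 →₀ ℕ) (h1 : α ≤ m) (h2 : β ≤ m) : β ≤ m - α := by
    intro v
    have := h1 v
    have := h2 v
    have := hdisj v
    simp only [Finsupp.tsub_apply]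
    omega
  obtain ⟨q, hq⟩ := MvPowerSeries.exists_binomial_division
    (wt := fun m => m 0 + m 1 + m 2) hwt hle r₁
  refine ⟨r₁ - (monomial α 1 - monomial β 1) * q, ?_,
    fun m hm => ?_⟩
  · rw [← sub_add]
    exact add_mem hr₁ (I.mul_mem_right _ hI)
  · obtain ⟨hα', t, n, hn, hf⟩ := hq m hm
    have hv (v) : n v + t * β v = m v + t * α v := by simpa using DFunLike.congr_fun hn v
    refine hPQ m n t (hP n hf) ?_ (hv 3) (hv 4) (hv 5)
    by_contra! h
    refine hα' fun v => ?_
    fin_cases v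
    exacts [by simp [hα], by simp [hα], by simp [hα], h.1, h.2.1, h.2.2]

theorem monomial_sub_monomial_mem {I : Ideal (MvPowerSeries (Fin 6) k)} {a b c d : Fin 6}
    (h : X a * X b - X c * X d ∈ I) :
    monomial (single a 1 + single b 1) 1 -
      monomial (single c 1 + single d 1) 1 ∈ I := by
  simpa [MvPowerSeries.X_def, MvPowerSeries.monomial_mul_monomial] using h

/-- Modulo `I₂(φ)` every power series is a `k[[x, y, z]]`-combination of `1, w, s, t`. -/
theorem exists_normalForm (r : MvPowerSeries (Fin 6) k) :
    ∃ r', r - r' ∈ I2sym k ∧ ∀ m, coeff m r' ≠ 0 → m 3 + m 4 + m 5 ≤ 1 := by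
  have hww : X 3 * X 3 - X 0 * X 1
      ∈ I2sym k := by
    simpa [symMat, px, py, pz, pw, ps, pt] using neg_mem
      (minor_mem_I2sym (k := k) (i := 0) (i' := 1) (j := 0) (j' := 1) (by decide) (by decide))
  have htt : X 5 * X 5 - X 0 * X 2
      ∈ I2sym k := by
    simpa [symMat, px, py, pz, pw, ps, pt] using neg_mem
      (minor_mem_I2sym (k := k) (i := 0) (i' := 2) (j := 0) (j' := 2) (by decide) (by decide))
  have hss : X 4 * X 4 - X 1 * X 2
      ∈ I2sym k := by
    simpa [symMat, px, py, pz, pw, ps, pt] using neg_mem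
      (minor_mem_I2sym (k := k) (i := 1) (i' := 2) (j := 1) (j' := 2) (by decide) (by decide))
  have hwt : X 3 * X 5 - X 0 * X 4
      ∈ I2sym k := by
    simpa [symMat, px, py, pz, pw, ps, pt, mul_comm] using neg_mem
      (minor_mem_I2sym (k := k) (i := 0) (i' := 1) (j := 0) (j' := 2) (by decide) (by decide))
  have hws : X 3 * X 4 - X 1 * X 5
      ∈ I2sym k := by
    simpa [symMat, px, py, pz, pw, ps, pt, mul_comm] using
      (minor_mem_I2sym (k := k) (i := 0) (i' := 1) (j := 1) (j' := 2) (by decide) (by decide))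
  have hst : X 4 * X 5 - X 2 * X 3
      ∈ I2sym k := by
    simpa [symMat, px, py, pz, pw, ps, pt, mul_comm] using neg_mem
      (minor_mem_I2sym (k := k) (i := 0) (i' := 2) (j := 1) (j' := 2) (by decide) (by decide))
  have h0 : ∃ r', r - r' ∈ I2sym k ∧ ∀ m, coeff m r' ≠ 0 → True :=
    ⟨r, by simp, fun _ _ => trivial⟩
  have h1 := exists_sub_mem_of_monomial_sub_mem (monomial_sub_monomial_mem hww)
    (Q := fun m => m 3 ≤ 1) (by simp) (by simp) (by simp [Fin.forall_fin_succ])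
    (by simp; omega) h0
  have h2 := exists_sub_mem_of_monomial_sub_mem (monomial_sub_monomial_mem htt)
    (Q := fun m => m 3 ≤ 1 ∧ m 5 ≤ 1) (by simp) (by simp) (by simp [Fin.forall_fin_succ])
    (by simp; omega) h1
  have h3 := exists_sub_mem_of_monomial_sub_mem (monomial_sub_monomial_mem hss)
    (Q := fun m => m 3 ≤ 1 ∧ m 4 ≤ 1 ∧ m 5 ≤ 1) (by simp) (by simp)
    (by simp [Fin.forall_fin_succ]) (by simp; omega) h2
  have h4 := exists_sub_mem_of_monomial_sub_mem (monomial_sub_monomial_mem hwt)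
    (Q := fun m => m 3 + m 5 ≤ 1) (by simp) (by simp)
    (by simp [Fin.forall_fin_succ]) (by simp; omega) h3
  have h5 := exists_sub_mem_of_monomial_sub_mem (monomial_sub_monomial_mem hss)
    (Q := fun m => m 3 + m 5 ≤ 1 ∧ m 4 ≤ 1) (by simp) (by simp)
    (by simp [Fin.forall_fin_succ]) (by simp; omega) h4
  have h6 := exists_sub_mem_of_monomial_sub_mem (monomial_sub_monomial_mem hws)
    (Q := fun m => m 3 + m 5 ≤ 1 ∧ m 3 + m 4 ≤ 1 ∧ m 4 ≤ 1) (by simp) (by simp)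
    (by simp [Fin.forall_fin_succ]) (by simp; omega) h5
  exact exists_sub_mem_of_monomial_sub_mem (monomial_sub_monomial_mem hst)
    (by simp) (by simp) (by simp [Fin.forall_fin_succ]) (by simp; omega) h6

end VeroneseReduction

section Veronese

/-- The exponents of the monomials `a², b², c², ab, bc, ac`. -/
noncomputable def veroneseExponent : Fin 6 → Fin 3 →₀ ℕ :=
  ![single 0 2, single 1 2, single 2 2, single 0 1 + single 1 1, single 1 1 + single 2 1,
    single 0 1 + single 2 1]

theorem hasSubst_veronese (k : Type) [Field k] :
    MvPowerSeries.HasSubst fun i => monomial (veroneseExponent i) (1 : k) := by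
  classical
  refine MvPowerSeries.hasSubst_of_constantCoeff_zero fun i => ?_
  rw [← MvPowerSeries.coeff_zero_eq_constantCoeff_apply, MvPowerSeries.coeff_monomial, if_neg]
  intro h
  have h0 := DFunLike.congr_fun h 0
  have h1 := DFunLike.congr_fun h 1
  have h2 := DFunLike.congr_fun h 2
  fin_cases i <;> simp [veroneseExponent] at h0 h1 h2

/-- The homomorphism `k[[x, y, z, w, s, t]] → k[[a, b, c]]` with image the second Veronese
subring. -/
noncomputable def veroneseHom (k : Type) [Field k] :
    MvPowerSeries (Fin 6) k →ₐ[k] MvPowerSeries (Fin 3) k :=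
  MvPowerSeries.substAlgHom (hasSubst_veronese k)

/-- The exponent of the image of a monomial under `veroneseHom`. -/
noncomputable def veroneseWeight (d : Fin 6 →₀ ℕ) : Fin 3 →₀ ℕ := ∑ i, d i • veroneseExponent i

theorem veroneseWeight_apply (d : Fin 6 →₀ ℕ) :
    veroneseWeight d 0 = 2 * d 0 + d 3 + d 5 ∧ veroneseWeight d 1 = 2 * d 1 + d 3 + d 4 ∧
      veroneseWeight d 2 = 2 * d 2 + d 4 + d 5 := by
  simp [veroneseWeight, veroneseExponent, Fin.sum_univ_six, mul_comm]

variable {k : Type} [Field k]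

open Classical in
theorem coeff_veroneseHom (f : MvPowerSeries (Fin 6) k) (m : Fin 3 →₀ ℕ) :
    coeff m (veroneseHom k f) =
      ∑ᶠ d, if m = veroneseWeight d then coeff d f else 0 := by
  rw [veroneseHom, MvPowerSeries.substAlgHom_apply, MvPowerSeries.coeff_subst (hasSubst_veronese k)]
  refine finsum_congr fun d => ?_
  have : (d.prod fun s e => monomial (veroneseExponent s) (1 : k) ^ e) =
      monomial (veroneseWeight d) 1 := by
    rw [Finsupp.prod_fintype _ _ fun _ => pow_zero _]
    simp [MvPowerSeries.monomial_pow, veroneseWeight, Fin.prod_univ_six, Fin.sum_univ_six,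
      MvPowerSeries.monomial_mul_monomial]
  rw [this, MvPowerSeries.coeff_monomial]
  simp

theorem veroneseHom_X (i : Fin 6) :
    veroneseHom k (X i) = monomial (veroneseExponent i) 1 :=
  MvPowerSeries.substAlgHom_X (hasSubst_veronese k) i

theorem veroneseHom_eq_zero_of_mem {r : MvPowerSeries (Fin 6) k} (hr : r ∈ I2sym k) :
    veroneseHom k r = 0 := by
  suffices I2sym k ≤ RingHom.ker (veroneseHom k) from this hr
  refine Ideal.span_le.mpr ?_
  have key (i j : Fin 3) : veroneseHom k (symMat k i j) =
      X i * X j := by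
    fin_cases i <;> fin_cases j <;>
      simp [symMat, px, py, pz, pw, ps, pt, veroneseHom_X] <;>
      simp [veroneseExponent, MvPowerSeries.X_def, MvPowerSeries.monomial_mul_monomial,
        ← Finsupp.single_add, add_comm (single (1 : Fin 3) 1) (single 0 1),
        add_comm (single (2 : Fin 3) 1)]
  rintro _ ⟨i, i', j, j', -, -, rfl⟩
  rw [SetLike.mem_coe, RingHom.mem_ker, map_sub, map_mul, map_mul, key, key, key, key]
  ring

theorem even_of_coeff_veroneseHom_ne_zero (f : MvPowerSeries (Fin 6) k) (m : Fin 3 →₀ ℕ)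
    (h : coeff m (veroneseHom k f) ≠ 0) : Even (m 0 + m 1 + m 2) := by
  classical
  rw [coeff_veroneseHom] at h
  obtain ⟨d, rfl⟩ : ∃ d, m = veroneseWeight d := by
    by_contra! hne
    simp [hne] at h
  obtain ⟨h0, h1, h2⟩ := veroneseWeight_apply d
  rw [h0, h1, h2]
  exact ⟨d 0 + d 1 + d 2 + d 3 + d 4 + d 5, by ring⟩

theorem veroneseWeight_injOn :
    Set.InjOn veroneseWeight {d | d 3 + d 4 + d 5 ≤ 1} := by
  intro d hd d' hd' h
  have h0 := veroneseWeight_apply d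
  rw [h] at h0
  have h1 := veroneseWeight_apply d'
  simp only [Set.mem_ofPred_eq] at hd hd'
  ext v
  fin_cases v <;> dsimp <;> omega

theorem exists_veroneseWeight_eq {m : Fin 3 →₀ ℕ} (hm : Even (m 0 + m 1 + m 2)) :
    ∃ d, d 3 + d 4 + d 5 ≤ 1 ∧ veroneseWeight d = m := by
  have hm' := Nat.even_iff.mp hm
  have key (w s t : ℕ) (h : w + s + t ≤ 1) (h0 : (m 0 + w + t) % 2 = 0)
      (h1 : (m 1 + w + s) % 2 = 0) (h2 : (m 2 + s + t) % 2 = 0) :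
      ∃ d, d 3 + d 4 + d 5 ≤ 1 ∧ veroneseWeight d = m := by
    refine ⟨Finsupp.equivFunOnFinite.symm ![m 0 / 2, m 1 / 2, m 2 / 2, w, s, t], by simpa, ?_⟩
    have hd := veroneseWeight_apply
      (Finsupp.equivFunOnFinite.symm ![m 0 / 2, m 1 / 2, m 2 / 2, w, s, t])
    simp at hd
    ext v
    fin_cases v <;> dsimp <;> omega
  rcases Nat.mod_two_eq_zero_or_one (m 0) with h0 | h0 <;>
    rcases Nat.mod_two_eq_zero_or_one (m 1) with h1 | h1
  · exact key 0 0 0 (by omega) (by omega) (by omega) (by omega)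
  · exact key 0 1 0 (by omega) (by omega) (by omega) (by omega)
  · exact key 0 0 1 (by omega) (by omega) (by omega) (by omega)
  · exact key 1 0 0 (by omega) (by omega) (by omega) (by omega)

theorem coeff_veroneseHom_of_normalForm {r : MvPowerSeries (Fin 6) k}
    (hr : ∀ d, coeff d r ≠ 0 → d 3 + d 4 + d 5 ≤ 1) {d : Fin 6 →₀ ℕ}
    (hd : d 3 + d 4 + d 5 ≤ 1) :
    coeff (veroneseWeight d) (veroneseHom k r) = coeff d r := by
  classical
  rw [coeff_veroneseHom, finsum_eq_single _ d, if_pos rfl]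
  intro d' hne
  split_ifs with h
  · by_contra h0
    exact hne (veroneseWeight_injOn (hr d' h0) hd h.symm)
  · rfl

theorem mem_I2sym_iff {r : MvPowerSeries (Fin 6) k} : r ∈ I2sym k ↔ veroneseHom k r = 0 := by
  refine ⟨veroneseHom_eq_zero_of_mem, fun h => ?_⟩
  obtain ⟨r', hrr', hr'⟩ := exists_normalForm r
  have h0 : veroneseHom k r' = 0 := by
    have := veroneseHom_eq_zero_of_mem hrr'
    rwa [map_sub, h, zero_sub, neg_eq_zero] at this
  have : r' = 0 := by
    ext d
    rw [map_zero]
    by_contra hd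
    apply hd
    rw [← coeff_veroneseHom_of_normalForm hr' (hr' d hd), h0, map_zero]
  simpa [this] using hrr'

/-- The additive section of `veroneseHom` on its image with values in normal forms. -/
noncomputable def veroneseSection (k : Type) [Field k] :
    MvPowerSeries (Fin 3) k →+ MvPowerSeries (Fin 6) k where
  toFun f := fun d => if d 3 + d 4 + d 5 ≤ 1 then coeff (veroneseWeight d) f else 0
  map_zero' := funext fun d => by simp; rfl
  map_add' f g := funext fun d => by
    rw [map_add, ite_add_zero]
    rfl

theorem coeff_veroneseSection (f : MvPowerSeries (Fin 3) k) (d : Fin 6 →₀ ℕ) :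
    coeff d (veroneseSection k f) =
      if d 3 + d 4 + d 5 ≤ 1 then coeff (veroneseWeight d) f else 0 := rfl

open Classical in
theorem coeff_veroneseHom_veroneseSection (f : MvPowerSeries (Fin 3) k) (m : Fin 3 →₀ ℕ) :
    coeff m (veroneseHom k (veroneseSection k f)) =
      if Even (m 0 + m 1 + m 2) then coeff m f else 0 := by
  split_ifs with h
  · obtain ⟨d, hd, rfl⟩ := exists_veroneseWeight_eq h
    rw [coeff_veroneseHom_of_normalForm _ hd, coeff_veroneseSection, if_pos hd]
    intro d' hd'
    by_contra hne
    exact hd' (by rw [coeff_veroneseSection, if_neg hne])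
  · by_contra hne
    exact h (even_of_coeff_veroneseHom_ne_zero _ _ hne)

theorem veroneseHom_veroneseSection_mul (r : MvPowerSeries (Fin 6) k)
    (f : MvPowerSeries (Fin 3) k) :
    veroneseHom k (veroneseSection k (veroneseHom k r * f)) =
      veroneseHom k r * veroneseHom k (veroneseSection k f) := by
  classical
  ext m
  rw [coeff_veroneseHom_veroneseSection, MvPowerSeries.coeff_mul, MvPowerSeries.coeff_mul]
  trans ∑ u ∈ Finset.HasAntidiagonal.antidiagonal m, if Even (m 0 + m 1 + m 2) then
    coeff u.1 (veroneseHom k r) * coeff u.2 f else 0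
  · split_ifs <;> simp
  refine Finset.sum_congr rfl fun ⟨a, b⟩ hab => ?_
  rw [Finset.HasAntidiagonal.mem_antidiagonal] at hab
  subst hab
  by_cases h0 : coeff a (veroneseHom k r) = 0
  · simp [h0]
  · have ha := even_of_coeff_veroneseHom_ne_zero r a h0
    have : Even ((a + b) 0 + (a + b) 1 + (a + b) 2) ↔ Even (b 0 + b 1 + b 2) := by
      have hadd : (a + b) 0 + (a + b) 1 + (a + b) 2 = a 0 + a 1 + a 2 + (b 0 + b 1 + b 2) := by
        simp only [Finsupp.add_apply]
        ring
      rw [hadd, Nat.even_add, iff_true_left ha]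
    rw [coeff_veroneseHom_veroneseSection, mul_ite, mul_zero]
    simp only [this]

theorem veroneseHom_veroneseSection_one : veroneseHom k (veroneseSection k 1) = 1 := by
  classical
  ext m
  rw [coeff_veroneseHom_veroneseSection, MvPowerSeries.coeff_one]
  split_ifs with h1 h2 h2 <;> simp_all

end Veronese

/-- If `k` is a perfect field of characteristic `2` or `3`, then
`A = k[[x,y,z,w,s,t]]/I₂(φ)` is strongly `F`-regular. -/
theorem stmt15 (p : ℕ) (hp : p.Prime) (hp23 : p = 2 ∨ p = 3) (k : Type) [Field k] [CharP k p]
    (hperf : Function.Surjective fun x : k => x ^ p) :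
    StronglyFRegular p (MvPowerSeries (Fin 6) k ⧸ I2sym k) := by
  have : Fact p.Prime := ⟨hp⟩
  have : ExpChar k p := ExpChar.prime hp
  have : PerfectRing k p := PerfectRing.ofSurjective k p hperf
  refine stronglyFRegular_of_split_mvPowerSeries hp
    (Ideal.Quotient.lift (I2sym k) (veroneseHom k : _ →+* _)
      fun _ h => veroneseHom_eq_zero_of_mem h)
    ((Ideal.Quotient.mk (I2sym k)).toAddMonoidHom.comp (veroneseSection k)) (fun a g => ?_) ?_
  · obtain ⟨r, rfl⟩ := Ideal.Quotient.mk_surjective a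
    change Ideal.Quotient.mk _ (veroneseSection k (veroneseHom k r * g)) =
      Ideal.Quotient.mk _ (r * veroneseSection k g)
    rw [Ideal.Quotient.eq, mem_I2sym_iff, map_sub, map_mul (veroneseHom k), sub_eq_zero]
    exact veroneseHom_veroneseSection_mul r g
  · change Ideal.Quotient.mk _ (veroneseSection k 1) = Ideal.Quotient.mk _ 1
    rw [Ideal.Quotient.eq, mem_I2sym_iff, map_sub, map_one (veroneseHom k), sub_eq_zero]
    exact veroneseHom_veroneseSection_one
end

section
/- Let k be a field of characteristic p = 2 or p = 3, R = k[[x, y, z, w, s, t]] with maximal ideal 𝔪, Ω = (x, w, t, yz − s^2), and v = (x·w·t·(yz − s^2))^{p−1}. Then Ω^{[p]} : Ω = Ω^{[p]} + (v), and v ∉ 𝔪^{[p]} + ((xyzwts)^{p−1}). -/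
/-- `Ω = (x, w, t, yz - s²)`. -/
noncomputable def OmSym (k : Type) [Field k] : Ideal (MvPowerSeries (Fin 6) k) :=
  Ideal.span {px k, pw k, pt k, py k * pz k - ps k ^ 2}

/-- `v = (x·w·t·(yz - s²))^{p-1}`. -/
noncomputable def vSym (k : Type) [Field k] (p : ℕ) : MvPowerSeries (Fin 6) k :=
  (px k * pw k * pt k * (py k * pz k - ps k ^ 2)) ^ (p - 1)

section Colon

variable {R : Type} [CommRing R]

/-- `L` is a sequence each of whose members is a nonzerodivisor modulo `B`, the earlier members
and the `(n + 1)`-st powers of the later members. -/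
def PowRegular (n : ℕ) : Ideal R → List R → Prop
  | _, [] => True
  | B, a :: L =>
      (∀ r, a * r ∈ B ⊔ Ideal.ofList (L.map (· ^ (n + 1))) →
        r ∈ B ⊔ Ideal.ofList (L.map (· ^ (n + 1)))) ∧
      PowRegular n (B ⊔ Ideal.span {a}) L

theorem pow_mul_mem_of_nonzerodivisor {I : Ideal R} {a : R} (ha : ∀ r, a * r ∈ I → r ∈ I)
    (m : ℕ) {r : R} (hr : a ^ m * r ∈ I) : r ∈ I := by
  induction m with
  | zero => simpa using hr
  | succ m ih => exact ih (ha _ (by rwa [pow_succ', mul_assoc] at hr))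

theorem mem_sup_span_pow_of_pow_mul_mem {I : Ideal R} {a : R} (ha : ∀ r, a * r ∈ I → r ∈ I)
    (m l : ℕ) {r : R} (hr : a ^ m * r ∈ Ideal.span {a ^ (m + l)} ⊔ I) :
    r ∈ Ideal.span {a ^ l} ⊔ I := by
  obtain ⟨b, i, hi, h⟩ := Ideal.mem_span_singleton_sup.1 hr
  refine Ideal.mem_span_singleton_sup.2 ⟨b, r - b * a ^ l, ?_, by ring⟩
  refine pow_mul_mem_of_nonzerodivisor ha m ?_
  convert hi using 1
  linear_combination -h

/-- The colon of the ideal of powers of a regular sequence by the ideal of the sequence. -/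
theorem PowRegular.mem_of_forall_mul_mem {n : ℕ} {L : List R} :
    ∀ {B : Ideal R}, PowRegular n B L → ∀ {r : R},
      (∀ a ∈ L, r * a ∈ B ⊔ Ideal.ofList (L.map (· ^ (n + 1)))) →
      r ∈ B ⊔ Ideal.ofList (L.map (· ^ (n + 1))) ⊔ Ideal.span {L.prod ^ n} := by
  induction L with
  | nil => simp
  | cons a L ih =>
    intro B hL r hr
    obtain ⟨ha, hL⟩ := hL
    simp only [List.map_cons, Ideal.ofList_cons, List.prod_cons, List.mem_cons,
      forall_eq_or_imp, sup_left_comm B] at hr ⊢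
    set I := B ⊔ Ideal.ofList (L.map (· ^ (n + 1))) with hI
    obtain ⟨r₁, i, hi, rfl⟩ := Ideal.mem_span_singleton_sup.1
      (mem_sup_span_pow_of_pow_mul_mem ha 1 n (r := r) (by
        rw [add_comm, pow_one, mul_comm]; exact hr.1))
    have key : r₁ ∈ B ⊔ Ideal.span {a} ⊔ Ideal.ofList (L.map (· ^ (n + 1))) ⊔
        Ideal.span {L.prod ^ n} := by
      refine ih hL fun b hb => ?_
      rw [sup_comm B, sup_assoc, ← hI, ← pow_one a]
      refine mem_sup_span_pow_of_pow_mul_mem ha n 1 ?_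
      have h := sub_mem (hr.2 b hb) (Ideal.mem_sup_right (I.mul_mem_right b hi))
      convert h using 1
      ring
    rw [sup_comm B, sup_assoc (Ideal.span {a}), ← hI, sup_comm, Ideal.mem_span_singleton_sup] at key
    obtain ⟨c, j, hj, rfl⟩ := key
    obtain ⟨d, j', hj', rfl⟩ := Ideal.mem_span_singleton_sup.1 hj
    have h₁ : a ^ (n + 1) ∈ Ideal.span {a ^ (n + 1)} ⊔ I :=
      Ideal.mem_sup_left (Ideal.mem_span_singleton_self _)
    rw [sup_comm, Ideal.mem_span_singleton_sup]
    refine ⟨c, d * a ^ (n + 1) + (j' * a ^ n + i), ?_, by ring⟩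
    exact add_mem (Ideal.mul_mem_left _ _ h₁)
      (Ideal.mem_sup_right (add_mem (I.mul_mem_right _ hj') hi))

theorem prod_pow_mul_mem_ofList_map_pow (n : ℕ) {L : List R} {a : R} (ha : a ∈ L) :
    L.prod ^ n * a ∈ Ideal.ofList (L.map (· ^ (n + 1))) := by
  obtain ⟨c, hc⟩ := List.dvd_prod ha
  have h : a ^ (n + 1) ∈ Ideal.ofList (L.map (· ^ (n + 1))) :=
    Ideal.subset_span (List.mem_map_of_mem ha)
  rw [hc, show (a * c) ^ n * a = c ^ n * a ^ (n + 1) by ring]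
  exact Ideal.mul_mem_left _ _ h

theorem PowRegular.colon_eq {n : ℕ} {L : List R} (hL : PowRegular n ⊥ L) :
    Submodule.colon (Ideal.ofList (L.map (· ^ (n + 1)))) (Ideal.ofList L : Set R) =
      Ideal.ofList (L.map (· ^ (n + 1))) ⊔ Ideal.span {L.prod ^ n} := by
  refine le_antisymm (fun r hr => ?_) (sup_le (fun r hr => ?_) ?_)
  · have := hL.mem_of_forall_mul_mem (r := r) fun a ha => by
      rw [bot_sup_eq]
      exact Submodule.mem_colon.1 hr a (Ideal.subset_span ha)
    rwa [bot_sup_eq] at this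
  · exact Submodule.mem_colon.2 fun s _ => Ideal.mul_mem_right s _ hr
  · rw [Ideal.span_singleton_le_iff_mem]
    refine Submodule.mem_colon.2 fun s hs => ?_
    refine Submodule.span_induction (fun a ha => prod_pow_mul_mem_ofList_map_pow n ha) (by simp)
      (fun a b _ _ ha hb => ?_) (fun c a _ ha => ?_) hs
    · rw [smul_add]; exact add_mem ha hb
    · rw [smul_comm]; exact Ideal.mul_mem_left _ _ ha

theorem frobPow_ofList (p : ℕ) [ExpChar R p] (L : List R) :
    frobPow p (Ideal.ofList L) = Ideal.ofList (L.map (· ^ p)) :=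
  Ideal.map_ofList (frobenius R p) L

end Colon

namespace MvPowerSeries

variable {σ k : Type} [CommRing k]

/-- Division by the variable `X i`, dropping the terms which do not involve it. -/
noncomputable def divX (i : σ) : MvPowerSeries σ k →ₗ[k] MvPowerSeries σ k where
  toFun f := fun d => coeff (d + Finsupp.single i 1) f
  map_add' _ _ := rfl
  map_smul' _ _ := rfl

theorem coeff_divX (i : σ) (d : σ →₀ ℕ) (f : MvPowerSeries σ k) :
    coeff d (divX i f) = coeff (d + Finsupp.single i 1) f := rfl

theorem divX_X_mul (i : σ) (f : MvPowerSeries σ k) : divX i (X i * f) = f := by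
  ext d
  rw [coeff_divX, add_comm, X, coeff_add_monomial_mul, one_mul]

/-- The power series which commute with division by `X i`, i.e. which do not involve `X i`. -/
def freeOf (i : σ) : Subalgebra k (MvPowerSeries σ k) where
  carrier := {g | ∀ f, divX i (g * f) = g * divX i f}
  mul_mem' ha hb f := by rw [mul_assoc, ha, hb, mul_assoc]
  add_mem' ha hb f := by rw [add_mul, map_add, ha, hb, add_mul]
  algebraMap_mem' r f := by rw [← Algebra.smul_def, map_smul, Algebra.smul_def]

theorem X_mem_freeOf {i j : σ} (h : j ≠ i) : (X j : MvPowerSeries σ k) ∈ freeOf i := by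
  classical
  intro f
  ext d
  have hs : (d + Finsupp.single i 1 : σ →₀ ℕ) j = d j := by simp [h]
  simp only [coeff_divX, X, coeff_monomial_mul, Finsupp.single_le_iff, hs, one_mul]
  split_ifs with hd
  · congr 2
    ext l
    rcases eq_or_ne l j with rfl | hl
    · simp [h]
    · simp [hl.symm]
  · rfl

/-- The ideal `I` is stable under division by `X i`. -/
def DivXStable (i : σ) (I : Ideal (MvPowerSeries σ k)) : Prop :=
  ∀ f ∈ I, divX i f ∈ I

theorem divXStable_bot (i : σ) : DivXStable i (⊥ : Ideal (MvPowerSeries σ k)) := by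
  rintro f rfl
  simp

theorem DivXStable.sup {i : σ} {I J : Ideal (MvPowerSeries σ k)} (hI : DivXStable i I)
    (hJ : DivXStable i J) : DivXStable i (I ⊔ J) := by
  intro f hf
  obtain ⟨a, ha, b, hb, rfl⟩ := Submodule.mem_sup.1 hf
  rw [map_add]
  exact Submodule.add_mem_sup (hI a ha) (hJ b hb)

theorem divXStable_span_singleton {i : σ} {g : MvPowerSeries σ k} (hg : g ∈ freeOf i) :
    DivXStable i (Ideal.span {g}) := by
  intro f hf
  obtain ⟨a, rfl⟩ := Ideal.mem_span_singleton.1 hf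
  rw [hg a]
  exact Ideal.mul_mem_right _ _ (Ideal.mem_span_singleton_self g)

theorem DivXStable.mem_of_X_mul_mem {i : σ} {I : Ideal (MvPowerSeries σ k)}
    (hI : DivXStable i I) (r : MvPowerSeries σ k) (hr : X i * r ∈ I) : r ∈ I := by
  rw [← divX_X_mul i r]
  exact hI _ hr

theorem DivXStable.nonzerodivisor_sup {i : σ} {I : Ideal (MvPowerSeries σ k)}
    (hI : DivXStable i I) {g : MvPowerSeries σ k} (hg : g ∈ freeOf i)
    (hgI : ∀ r, g * r ∈ I → r ∈ I) (r : MvPowerSeries σ k)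
    (hr : g * r ∈ I ⊔ Ideal.span {X i}) : r ∈ I ⊔ Ideal.span {X i} := by
  rw [sup_comm, Ideal.mem_span_singleton_sup] at hr ⊢
  obtain ⟨b, a, ha, h⟩ := hr
  refine ⟨divX i r, r - divX i r * X i, hgI _ ?_, by ring⟩
  have h' := congrArg (divX i) h
  rw [map_add, mul_comm b, divX_X_mul, hg] at h'
  convert sub_mem ha (I.mul_mem_left (X i) (hI a ha)) using 1
  linear_combination X i * h' - h

theorem coeff_pow_char_eq_zero [Finite σ] (p : ℕ) [hp : Fact p.Prime] [CharP k p]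
    {f : MvPowerSeries σ k} (hf : constantCoeff f = 0) {d : σ →₀ ℕ} (hd : ∀ i, d i < p) :
    coeff d (f ^ p) = 0 := by
  rw [← map_frobenius_expand p hp.out.ne_zero, coeff_map]
  by_cases h : ∃ i, ¬ p ∣ d i
  · obtain ⟨i, hi⟩ := h
    rw [coeff_expand_of_not_dvd p hp.out.ne_zero f hi, map_zero]
  · push Not at h
    obtain rfl : d = 0 := by
      ext i
      exact Nat.eq_zero_of_dvd_of_lt (h i) (hd i)
    rw [coeff_zero_eq_constantCoeff_apply, constantCoeff_expand, hf, map_zero]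

/-- The ideal of power series with no monomial dividing the one with exponent `e`. -/
def coeffZeroIdeal (e : σ →₀ ℕ) : Ideal (MvPowerSeries σ k) where
  carrier := {f | ∀ d ≤ e, coeff d f = 0}
  zero_mem' _ _ := map_zero _
  add_mem' hf hg d hd := by rw [map_add, hf d hd, hg d hd, add_zero]
  smul_mem' c f hf d hd := by
    classical
    rw [smul_eq_mul, coeff_mul]
    refine Finset.sum_eq_zero fun x hx => ?_
    rw [hf x.2 ((Finset.HasAntidiagonal.mem_antidiagonal.1 hx ▸ le_add_self).trans hd), mul_zero]

end MvPowerSeries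

open MvPowerSeries

theorem quadric_ne_zero (k : Type) [Field k] : py k * pz k - ps k ^ 2 ≠ 0 := by
  classical
  intro h
  have h' := congrArg (coeff (Finsupp.single 4 2)) h
  have hyz : coeff (Finsupp.single (4 : Fin 6) 2) (py k * pz k) = 0 :=
    X_dvd_iff.1 (Dvd.intro _ rfl) _ (by simp)
  rw [map_sub, hyz, ps, coeff_X_pow] at h'
  simp at h'

theorem quadric_mem_freeOf (k : Type) [Field k] {i : Fin 6} (h₁ : 1 ≠ i) (h₂ : 2 ≠ i)
    (h₄ : 4 ≠ i) : py k * pz k - ps k ^ 2 ∈ freeOf (k := k) i :=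
  sub_mem (mul_mem (X_mem_freeOf h₁) (X_mem_freeOf h₂)) (pow_mem (X_mem_freeOf h₄) 2)

theorem powRegular_OmSym (k : Type) [Field k] (n : ℕ) :
    PowRegular n ⊥ [px k, pw k, pt k, py k * pz k - ps k ^ 2] := by
  have hX {i j : Fin 6} (h : j ≠ i) := divXStable_span_singleton (X_mem_freeOf (k := k) h)
  have hXp {i j : Fin 6} (h : j ≠ i) :=
    divXStable_span_singleton (pow_mem (X_mem_freeOf (k := k) h) (n + 1))
  have hf {i : Fin 6} (h₁ : 1 ≠ i) (h₂ : 2 ≠ i) (h₄ : 4 ≠ i) :=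
    divXStable_span_singleton (pow_mem (quadric_mem_freeOf k h₁ h₂ h₄) (n + 1))
  simp only [PowRegular, List.map_cons, List.map_nil, Ideal.ofList_cons, Ideal.ofList_nil,
    bot_sup_eq, sup_bot_eq, and_true]
  refine ⟨?_, ?_, ?_, ?_⟩
  · exact ((hXp (by decide)).sup ((hXp (by decide)).sup
      (hf (by decide) (by decide) (by decide)))).mem_of_X_mul_mem
  · exact ((hX (by decide)).sup ((hXp (by decide)).sup
      (hf (by decide) (by decide) (by decide)))).mem_of_X_mul_mem
  · exact (((hX (by decide)).sup (hX (by decide))).sup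
      (hf (by decide) (by decide) (by decide))).mem_of_X_mul_mem
  · have hq {i : Fin 6} (h₁ : 1 ≠ i) (h₂ : 2 ≠ i) (h₄ : 4 ≠ i) := quadric_mem_freeOf k h₁ h₂ h₄
    have h₀ := (divXStable_bot (k := k) (0 : Fin 6)).nonzerodivisor_sup
      (hq (by decide) (by decide) (by decide)) fun r hr => by
        simpa [quadric_ne_zero k] using hr
    rw [bot_sup_eq] at h₀
    have h₃ := (hX (i := 3) (j := 0) (by decide)).nonzerodivisor_sup
      (hq (by decide) (by decide) (by decide)) h₀
    exact ((hX (i := 5) (j := 0) (by decide)).sup (hX (j := 3) (by decide))).nonzerodivisor_sup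
      (hq (by decide) (by decide) (by decide)) h₃

/-- The exponent of `(xyzwt)^n`. -/
noncomputable def exponentWithoutS (n : ℕ) : Fin 6 →₀ ℕ :=
  Finsupp.equivFunOnFinite.symm ![n, n, n, n, 0, n]

theorem coeff_vSym (k : Type) [Field k] (n : ℕ) :
    coeff (exponentWithoutS n) (vSym k (n + 1)) = 1 := by
  classical
  have hdvd : ps k ∣ vSym k (n + 1) - (px k * pw k * pt k * (py k * pz k)) ^ n := by
    refine dvd_trans ⟨-(px k * pw k * pt k * ps k), ?_⟩ (sub_dvd_pow_sub_pow _ _ n)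
    ring
  have h₀ : coeff (exponentWithoutS n)
      (vSym k (n + 1) - (px k * pw k * pt k * (py k * pz k)) ^ n) = 0 :=
    X_dvd_iff.1 hdvd _ rfl
  rw [map_sub, sub_eq_zero] at h₀
  rw [h₀]
  simp only [px, py, pz, pw, pt, mul_pow, X_pow_eq, monomial_mul_monomial, coeff_monomial, one_mul]
  refine if_pos ?_
  ext i
  fin_cases i <;> simp [exponentWithoutS]

theorem vSym_notMem (p : ℕ) [hp : Fact p.Prime] (k : Type) [Field k] [CharP k p] :
    vSym k p ∉ frobPow p (IsLocalRing.maximalIdeal (MvPowerSeries (Fin 6) k)) ⊔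
      Ideal.span {(px k * py k * pz k * pw k * pt k * ps k) ^ (p - 1)} := by
  obtain ⟨n, rfl⟩ := Nat.exists_eq_add_one_of_ne_zero hp.out.ne_zero
  have hn : 0 < n := by have := hp.out.two_le; omega
  have he (i : Fin 6) : exponentWithoutS n i < n + 1 := by
    fin_cases i <;> simp [exponentWithoutS]
  have hle : frobPow (n + 1) (IsLocalRing.maximalIdeal (MvPowerSeries (Fin 6) k)) ⊔
      Ideal.span {(px k * py k * pz k * pw k * pt k * ps k) ^ (n + 1 - 1)} ≤
      coeffZeroIdeal (exponentWithoutS n) := by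
    refine sup_le (Ideal.span_le.2 ?_) (Ideal.span_le.2 ?_)
    · rintro _ ⟨f, hf, rfl⟩ d hd
      refine coeff_pow_char_eq_zero (n + 1) ?_ fun i => (hd i).trans_lt (he i)
      by_contra hc
      exact hf (isUnit_iff_constantCoeff.2 (isUnit_iff_ne_zero.2 hc))
    · rintro _ rfl d hd
      have hds : d 4 = 0 := Nat.le_zero.1 (hd 4)
      exact X_dvd_iff.1 ((Dvd.intro_left _ rfl : ps k ∣ _).trans (dvd_pow_self _ hn.ne')) d hds
  intro hv
  exact one_ne_zero ((coeff_vSym k n).symm.trans (hle hv _ le_rfl))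

/-- For `p = 2` or `p = 3`: `Ω^{[p]} : Ω = Ω^{[p]} + (v)` and
`v ∉ 𝔪^{[p]} + ((xyzwts)^{p-1})`. -/
theorem stmt16 (p : ℕ) (hp : p.Prime) (hp23 : p = 2 ∨ p = 3) (k : Type) [Field k] [CharP k p] :
    Submodule.colon (frobPow p (OmSym k)) (OmSym k) =
      frobPow p (OmSym k) ⊔ Ideal.span {vSym k p} ∧
    vSym k p ∉
      frobPow p (IsLocalRing.maximalIdeal (MvPowerSeries (Fin 6) k)) ⊔
        Ideal.span {(px k * py k * pz k * pw k * pt k * ps k) ^ (p - 1)} := by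
  have : Fact p.Prime := ⟨hp⟩
  refine ⟨?_, vSym_notMem p k⟩
  have : CharP (MvPowerSeries (Fin 6) k) p :=
    charP_of_injective_ringHom (MvPowerSeries.C_injective) p
  obtain ⟨n, rfl⟩ := Nat.exists_eq_add_one_of_ne_zero hp.ne_zero
  have hΩ : OmSym k = Ideal.ofList [px k, pw k, pt k, py k * pz k - ps k ^ 2] := by
    simp [OmSym, Ideal.ofList, Set.insert_def]
  have hv : vSym k (n + 1) = [px k, pw k, pt k, py k * pz k - ps k ^ 2].prod ^ n := by
    simp [vSym, mul_assoc]
  rw [hΩ, hv, frobPow_ofList]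
  exact (powRegular_OmSym k n).colon_eq
end

section
/- Let k be a field of characteristic 3, X = (x_{ij}) a 4 × 3 matrix of indeterminates, R = k[[X]], and I = I_3(X) the ideal generated by the 3 × 3 minors of X. Then I^{[3]} : I ≠ I^{[3]} + I^4. -/
/-- For the generic `4 × 3` matrix `X` over `R = k[[X]]`, `Gmin43 k i` is the `3 × 3` minor
obtained by deleting the `i`-th row. -/
noncomputable def Gmin43 (k : Type) [Field k] (i : Fin 4) :
    MvPowerSeries (Fin 4 × Fin 3) k :=
  (Matrix.of fun r c : Fin 3 =>
    (MvPowerSeries.X (i.succAbove r, c) : MvPowerSeries (Fin 4 × Fin 3) k)).det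

/-- `I = I₃(X)`, the ideal generated by the `3 × 3` minors of the `4 × 3` matrix `X`. -/
noncomputable def I43 (k : Type) [Field k] : Ideal (MvPowerSeries (Fin 4 × Fin 3) k) :=
  Ideal.span (Set.range (Gmin43 k))

/-- The bilinear form `(p₀q₁ - q₀p₁)(p₂ - q₂)` built from two rows of length three. -/
def pairForm {A : Type*} [CommRing A] (p q : Fin 3 → A) : A :=
  (p 0 * q 1 - q 0 * p 1) * (p 2 - q 2)

/-- A cubic form in `v` through which `pairForm` is controlled in characteristic three. -/
def cubicForm {A : Type*} [CommRing A] (p q r v : Fin 3 → A) : A :=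
  v 0 ^ 2 * (p 1 * q 2 - p 2 * q 1) * (v 2 * r 1 - v 1 * r 2)
    + v 1 ^ 2 * (p 2 * q 0 - p 0 * q 2) * (v 0 * r 2 - v 2 * r 0)
    + v 2 ^ 2 * (p 0 * q 1 - p 1 * q 0) * (v 1 * r 0 - v 0 * r 1)
    + v 0 * v 1 * v 2 * (r 1 * (p 2 * q 0 - p 0 * q 2) - r 0 * (p 1 * q 2 - p 2 * q 1))

/-- The minor of a `4 × 3` matrix obtained by deleting the `i`-th row. -/
def maxMinor {A : Type*} [CommRing A] (x : Fin 4 → Fin 3 → A) (i : Fin 4) : A :=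
  (Matrix.of fun r c : Fin 3 => x (i.succAbove r) c).det

/-- A polynomial in the entries of `x` which, in characteristic three, multiplies the maximal
minors into the ideal generated by their cubes. -/
def colonWitness {A : Type*} [CommRing A] (x : Fin 4 → Fin 3 → A) : A :=
  pairForm (-maxMinor x 1 • x 1) (maxMinor x 2 • x 2)
    + pairForm (maxMinor x 0 • x 0) (-maxMinor x 3 • x 3)

/-- Exponents of a monomial that occurs in `colonWitness` and not in `I^{[3]} + I⁴`. -/
def witnessExponent : Fin 4 → Fin 3 → ℕ :=
  ![![2, 1, 0], ![1, 0, 2], ![0, 2, 1], ![1, 1, 1]]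

section CommRing

variable {A : Type*} [CommRing A]

lemma pairForm_comm (p q : Fin 3 → A) : pairForm p q = pairForm q p := by
  simp only [pairForm]
  ring

lemma cubicForm_smul (p q r v : Fin 3 → A) (t : A) :
    cubicForm p q r (t • v) = cubicForm p q r v * t ^ 3 := by
  simp only [cubicForm, Pi.smul_apply, smul_eq_mul]
  ring

lemma det_mul_pairForm_add (h3 : (3 : A) = 0) (p q r : Fin 3 → A) (a b c : A) :
    (Matrix.of ![p, q, r]).det *
        (pairForm (a • p) (b • q) + pairForm (-(a • p + b • q + c • r)) (c • r)) =
      cubicForm p q r (a • p + b • q + c • r) -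
        (cubicForm p q r p * a ^ 3 + cubicForm p q r q * b ^ 3 + cubicForm p q r r * c ^ 3) := by
  rw [← sub_eq_zero]
  simp only [Matrix.det_fin_three, pairForm, cubicForm, Matrix.of_apply, Matrix.cons_val,
    Pi.add_apply, Pi.neg_apply, Pi.smul_apply, smul_eq_mul]
  grind

lemma det_mul_pairForm_mem (h3 : (3 : A) = 0) {J : Ideal A} {o p q r : Fin 3 → A} {d a b c : A}
    (h : d • o + (a • p + b • q + c • r) = 0)
    (hd : d ^ 3 ∈ J) (ha : a ^ 3 ∈ J) (hb : b ^ 3 ∈ J) (hc : c ^ 3 ∈ J) :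
    (Matrix.of ![p, q, r]).det * (pairForm (a • p) (b • q) + pairForm (d • o) (c • r)) ∈ J := by
  have hsum : a • p + b • q + c • r = (-d) • o := by
    rw [neg_smul]
    exact eq_neg_of_add_eq_zero_right h
  rw [eq_neg_of_add_eq_zero_left h, det_mul_pairForm_add h3, hsum, cubicForm_smul]
  have hd' : (-d) ^ 3 ∈ J := by
    rw [Odd.neg_pow (by decide)]
    exact J.neg_mem hd
  exact J.sub_mem (J.mul_mem_left _ hd') (J.add_mem (J.add_mem (J.mul_mem_left _ ha)
    (J.mul_mem_left _ hb)) (J.mul_mem_left _ hc))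

lemma maxMinor_eq (x : Fin 4 → Fin 3 → A) :
    maxMinor x 0 = (Matrix.of ![x 1, x 2, x 3]).det ∧
    maxMinor x 1 = (Matrix.of ![x 0, x 2, x 3]).det ∧
    maxMinor x 2 = (Matrix.of ![x 0, x 1, x 3]).det ∧
    maxMinor x 3 = (Matrix.of ![x 0, x 1, x 2]).det := by
  refine ⟨?_, ?_, ?_, ?_⟩ <;>
  · rw [maxMinor]
    congr 2
    funext r
    fin_cases r <;> rfl

lemma sum_maxMinor_smul (x : Fin 4 → Fin 3 → A) :
    maxMinor x 0 • x 0 + -maxMinor x 1 • x 1 + maxMinor x 2 • x 2 + -maxMinor x 3 • x 3 = 0 := by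
  obtain ⟨h0, h1, h2, h3⟩ := maxMinor_eq x
  rw [h0, h1, h2, h3]
  funext j
  simp only [Matrix.det_fin_three, Matrix.of_apply, Matrix.cons_val, Pi.add_apply, Pi.smul_apply,
    smul_eq_mul, Pi.zero_apply]
  fin_cases j <;> simp only [Fin.zero_eta, Fin.mk_one, Fin.reduceFinMk] <;> ring

lemma colonWitness_mul_maxMinor_mem (h3 : (3 : A) = 0) {J : Ideal A} {x : Fin 4 → Fin 3 → A}
    (hJ : ∀ i, maxMinor x i ^ 3 ∈ J) (i : Fin 4) : colonWitness x * maxMinor x i ∈ J := by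
  have hneg : ∀ i, (-maxMinor x i) ^ 3 ∈ J := fun i => by
    rw [Odd.neg_pow (by decide)]
    exact J.neg_mem (hJ i)
  obtain ⟨e0, e1, e2, e3⟩ := maxMinor_eq x
  have hsum := sum_maxMinor_smul x
  have hdet : ∀ p q r : Fin 3 → A,
      (Matrix.of ![p, q, r]).det = -(Matrix.of ![p, r, q]).det := fun p q r => by
    simp only [Matrix.det_fin_three, Matrix.of_apply, Matrix.cons_val]
    ring
  have hdet' : ∀ p q r : Fin 3 → A,
      (Matrix.of ![p, q, r]).det = (Matrix.of ![q, r, p]).det := fun p q r => by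
    simp only [Matrix.det_fin_three, Matrix.of_apply, Matrix.cons_val]
    ring
  have key := @det_mul_pairForm_mem A _ h3 J
  rw [colonWitness, mul_comm]
  fin_cases i
  · simp only [Fin.zero_eta]
    nth_rw 1 [e0]
    exact key (by rw [← hsum]; abel) (hJ 0) (hneg 1) (hJ 2) (hneg 3)
  · simp only [Fin.mk_one]
    nth_rw 1 [e1]
    rw [hdet, neg_mul, neg_mem_iff, add_comm]
    exact key (by rw [← hsum]; abel) (hneg 1) (hJ 0) (hneg 3) (hJ 2)
  · simp only [Fin.reduceFinMk]
    nth_rw 1 [e2]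
    rw [hdet, neg_mul, neg_mem_iff, add_comm, pairForm_comm (-maxMinor x 1 • x 1)]
    exact key (by rw [← hsum]; abel) (hJ 2) (hJ 0) (hneg 3) (hneg 1)
  · simp only [Fin.reduceFinMk]
    nth_rw 1 [e3]
    rw [hdet', pairForm_comm (maxMinor x 0 • x 0)]
    exact key (by rw [← hsum]; abel) (hneg 3) (hneg 1) (hJ 2) (hJ 0)

lemma prod_row_eq_zero {y : Fin 4 → Fin 3 → A}
    (hy : ∀ i c, y i c ^ (witnessExponent i c + 1) = 0) (i : Fin 4) (f : Fin 4 → Fin 3) :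
    ∏ j, y i (f j) = 0 := by
  obtain ⟨c, -, hc⟩ : ∃ c ∈ Finset.univ,
      witnessExponent i c < (Finset.univ.filter fun j => f j = c).card := by
    apply Finset.exists_lt_of_sum_lt
    rw [← Finset.card_eq_sum_card_fiberwise (fun _ _ => Finset.mem_coe.2 (Finset.mem_univ _))]
    fin_cases i <;> simp [witnessExponent, Fin.sum_univ_three]
  rw [← Finset.prod_fiberwise' Finset.univ f (fun c => y i c)]
  apply Finset.prod_eq_zero (Finset.mem_univ c)
  rw [Finset.prod_const]
  exact pow_eq_zero_of_le hc (hy i c)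

lemma span_row_pow_four {y : Fin 4 → Fin 3 → A}
    (hy : ∀ i c, y i c ^ (witnessExponent i c + 1) = 0) (i : Fin 4) :
    Ideal.span (Set.range (y i)) ^ 4 = ⊥ := by
  rw [Ideal.span, Submodule.span_pow, Submodule.span_eq_bot]
  intro a ha
  obtain ⟨f, rfl⟩ := Set.mem_pow.1 ha
  choose g hg using fun j => (f j).2
  simp only [List.prod_ofFn, ← hg]
  exact prod_row_eq_zero hy i g

lemma maxMinor_mem_span_row (y : Fin 4 → Fin 3 → A) {i j : Fin 4} (h : j ≠ i) :
    maxMinor y j ∈ Ideal.span (Set.range (y i)) := by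
  obtain ⟨r, rfl⟩ := Fin.exists_succAbove_eq h.symm
  rw [maxMinor, Matrix.det_succ_row _ r]
  refine Ideal.sum_mem _ fun c _ => Ideal.mul_mem_right _ _ (Ideal.mul_mem_left _ _ ?_)
  exact Ideal.subset_span ⟨c, rfl⟩

lemma maxMinor_pow_three_eq_zero (h3 : (3 : A) = 0) {y : Fin 4 → Fin 3 → A}
    (hy : ∀ i c, y i c ^ 3 = 0) (i : Fin 4) : maxMinor y i ^ 3 = 0 := by
  rw [maxMinor, Matrix.det_fin_three]
  simp only [Matrix.of_apply]
  have h0 := hy (i.succAbove 0)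
  have h1 := hy (i.succAbove 1)
  have h2 := hy (i.succAbove 2)
  grind

lemma entry_relations {y : Fin 4 → Fin 3 → A}
    (hy : ∀ i c, y i c ^ (witnessExponent i c + 1) = 0) :
    (y 0 0 ^ 3 = 0 ∧ y 0 1 ^ 2 = 0 ∧ y 0 2 = 0) ∧ (y 1 0 ^ 2 = 0 ∧ y 1 1 = 0 ∧ y 1 2 ^ 3 = 0) ∧
      (y 2 0 = 0 ∧ y 2 1 ^ 3 = 0 ∧ y 2 2 ^ 2 = 0) ∧
      (y 3 0 ^ 2 = 0 ∧ y 3 1 ^ 2 = 0 ∧ y 3 2 ^ 2 = 0) := by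
  simpa [witnessExponent, Fin.forall_fin_succ] using hy

lemma prod_maxMinor_eq_zero (h3 : (3 : A) = 0) {y : Fin 4 → Fin 3 → A}
    (hy : ∀ i c, y i c ^ (witnessExponent i c + 1) = 0) : ∏ i, maxMinor y i = 0 := by
  obtain ⟨e0, e1, e2, e3⟩ := maxMinor_eq y
  obtain ⟨⟨h00, h01, h02⟩, ⟨h10, h11, h12⟩, ⟨h20, h21, h22⟩, h30, h31, h32⟩ := entry_relations hy
  rw [Fin.prod_univ_four, e0, e1, e2, e3]
  simp only [Matrix.det_fin_three, Matrix.of_apply, Matrix.cons_val, h02, h11, h20, mul_zero,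
    zero_mul, add_zero, sub_zero]
  clear hy e0 e1 e2 e3
  grind

lemma colonWitness_eq_prod (h3 : (3 : A) = 0) {y : Fin 4 → Fin 3 → A}
    (hy : ∀ i c, y i c ^ (witnessExponent i c + 1) = 0) :
    colonWitness y = ∏ i, ∏ c, y i c ^ witnessExponent i c := by
  obtain ⟨e0, e1, e2, e3⟩ := maxMinor_eq y
  obtain ⟨⟨h00, h01, h02⟩, ⟨h10, h11, h12⟩, ⟨h20, h21, h22⟩, h30, h31, h32⟩ := entry_relations hy
  simp only [colonWitness, pairForm, e0, e1, e2, e3, Matrix.det_fin_three, Matrix.of_apply,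
    Matrix.cons_val, Pi.smul_apply, smul_eq_mul, Fin.prod_univ_four, Fin.prod_univ_three,
    witnessExponent, h02, h11, h20, mul_zero, zero_mul, add_zero, sub_zero, pow_zero,
    pow_one, one_mul, mul_one]
  clear hy e0 e1 e2 e3
  grind

lemma span_maxMinor_pow_four (h3 : (3 : A) = 0) {y : Fin 4 → Fin 3 → A}
    (hy : ∀ i c, y i c ^ (witnessExponent i c + 1) = 0) :
    Ideal.span (Set.range (maxMinor y)) ^ 4 = ⊥ := by
  rw [Ideal.span, Submodule.span_pow, Submodule.span_eq_bot]
  intro a ha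
  obtain ⟨f, rfl⟩ := Set.mem_pow.1 ha
  choose g hg using fun j => (f j).2
  simp only [List.prod_ofFn, ← hg]
  by_cases hsurj : Function.Surjective g
  · rw [← prod_maxMinor_eq_zero h3 hy]
    exact (Finite.surjective_iff_bijective.1 hsurj).prod_comp _
  · obtain ⟨i, hi⟩ := not_forall.1 hsurj
    rw [← Ideal.mem_bot, ← span_row_pow_four hy i]
    have := Ideal.prod_mem_prod (s := Finset.univ) fun j (_ : j ∈ Finset.univ) =>
      maxMinor_mem_span_row y fun h : g j = i => hi ⟨j, h⟩
    simpa using this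

end CommRing

lemma prod_X_pow_notMem {σ k : Type*} [Fintype σ] [Field k] (e : σ → ℕ) :
    ∏ s, (MvPowerSeries.X s : MvPowerSeries σ k) ^ e s ∉
      Ideal.span (Set.range fun s => (MvPowerSeries.X s : MvPowerSeries σ k) ^ (e s + 1)) := by
  classical
  intro h
  obtain ⟨c, hc⟩ := (Ideal.mem_span_range_iff_exists_fun).1 h
  let m : σ →₀ ℕ := Finsupp.equivFunOnFinite.symm e
  have hm : ∏ s, (MvPowerSeries.X s : MvPowerSeries σ k) ^ e s = MvPowerSeries.monomial m 1 := by
    rw [MvPowerSeries.monomial_eq', map_one, one_mul, Finsupp.prod_fintype _ _ fun _ => pow_zero _]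
    rfl
  have hcoeff := congrArg (MvPowerSeries.coeff m) hc
  rw [hm, MvPowerSeries.coeff_monomial_same, map_sum] at hcoeff
  refine zero_ne_one ((Finset.sum_eq_zero fun s _ => ?_).symm.trans hcoeff)
  exact MvPowerSeries.X_pow_dvd_iff.1 (Dvd.intro_left (c s) rfl) m (Nat.lt_succ_self _)

/-- For `k` of characteristic `3`, `I^{[3]} : I ≠ I^{[3]} + I⁴`. -/
theorem stmt17 (k : Type) [Field k] [CharP k 3] :
    Submodule.colon (frobPow 3 (I43 k)) (I43 k) ≠ frobPow 3 (I43 k) ⊔ I43 k ^ 4 := by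
  let x : Fin 4 → Fin 3 → MvPowerSeries (Fin 4 × Fin 3) k := fun i c => MvPowerSeries.X (i, c)
  have hI : I43 k = Ideal.span (Set.range (maxMinor x)) := rfl
  have : CharP (MvPowerSeries (Fin 4 × Fin 3) k) 3 :=
    charP_of_injective_ringHom MvPowerSeries.C_injective 3
  have h3 : (3 : MvPowerSeries (Fin 4 × Fin 3) k) = 0 := by
    exact_mod_cast CharP.cast_eq_zero (MvPowerSeries (Fin 4 × Fin 3) k) 3
  let N : Ideal (MvPowerSeries (Fin 4 × Fin 3) k) := Ideal.span (Set.range fun s =>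
    (MvPowerSeries.X s) ^ (witnessExponent s.1 s.2 + 1))
  let π := Ideal.Quotient.mk N
  let y : Fin 4 → Fin 3 → MvPowerSeries (Fin 4 × Fin 3) k ⧸ N := fun i c => π (x i c)
  have h3' : (3 : MvPowerSeries (Fin 4 × Fin 3) k ⧸ N) = 0 := by
    rw [← map_ofNat π 3, show (OfNat.ofNat 3 : MvPowerSeries (Fin 4 × Fin 3) k) = 0 from h3,
      map_zero]
  have hy : ∀ i c, y i c ^ (witnessExponent i c + 1) = 0 := fun i c => by
    rw [← map_pow]
    exact Ideal.Quotient.eq_zero_iff_mem.2 (Ideal.subset_span ⟨(i, c), rfl⟩)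
  have hy3 : ∀ i c, y i c ^ 3 = 0 := fun i c =>
    pow_eq_zero_of_le (by fin_cases i <;> fin_cases c <;> decide) (hy i c)
  have hminor : ∀ i, π (maxMinor x i) = maxMinor y i := fun i => by
    rw [maxMinor, RingHom.map_det]
    rfl
  have hmap : (I43 k).map π = Ideal.span (Set.range (maxMinor y)) := by
    rw [hI, Ideal.map_span, ← Set.range_comp]
    exact congrArg (fun f => Ideal.span (Set.range f)) (funext hminor)
  have hcube : ∀ j, maxMinor x j ^ 3 ∈ frobPow 3 (I43 k) := fun j =>
    Ideal.subset_span ⟨maxMinor x j, Ideal.subset_span ⟨j, rfl⟩, rfl⟩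
  intro heq
  have hmem : colonWitness x ∈ frobPow 3 (I43 k) ⊔ I43 k ^ 4 := by
    rw [← heq, hI, Ideal.span, Submodule.colon_span, Submodule.mem_colon]
    rintro _ ⟨i, rfl⟩
    exact colonWitness_mul_maxMinor_mem h3 hcube i
  have hfrob : frobPow 3 (I43 k) ≤ N := by
    have hle : I43 k ≤ N.comap (frobenius _ 3) := by
      rw [hI, Ideal.span_le]
      rintro _ ⟨i, rfl⟩
      refine Ideal.mem_comap.2 (Ideal.Quotient.eq_zero_iff_mem.1 ?_)
      change π (maxMinor x i ^ 3) = 0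
      rw [map_pow, hminor, maxMinor_pow_three_eq_zero h3' hy3]
    refine Ideal.span_le.2 ?_
    rintro _ ⟨f, hf, rfl⟩
    exact hle hf
  have hpow : I43 k ^ 4 ≤ N := by
    rw [← Ideal.mk_ker (I := N), ← Ideal.map_eq_bot_iff_le_ker, Ideal.map_pow]
    exact (congrArg (· ^ 4) hmap).trans (span_maxMinor_pow_four h3' hy)
  have hzero : π (colonWitness x) = 0 := Ideal.Quotient.eq_zero_iff_mem.2 (sup_le hfrob hpow hmem)
  have hwit : π (colonWitness x) = colonWitness y := by
    simp only [colonWitness, pairForm, map_add, map_mul, map_sub, map_neg, hminor, Pi.smul_apply,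
      smul_eq_mul, y]
  apply prod_X_pow_notMem (k := k) fun s : Fin 4 × Fin 3 => witnessExponent s.1 s.2
  rw [← Ideal.Quotient.eq_zero_iff_mem, ← hzero]
  change _ = π _
  rw [hwit, colonWitness_eq_prod h3' hy, Fintype.prod_prod_type]
  simp only [map_prod, map_pow]
  rfl
end
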